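/- Let s ∈ ℂ be a root of unity with s³ ≠ 1. Then the formal power series E(t,s) = ∑_{n≥0} (∑_{k∈ℤ} e_{n,k} s^k) t^n ∈ ℂ[[t]] is algebraic over ℂ(t): there exists a nonzero polynomial P ∈ ℂ[X,Y] with P(t, E(t,s)) = 0 in ℂ[[t]]. -/

import Mathlib

open scoped BigOperators
noncomputable section

abbrev WSt : Type := ℤ × ℕ × ℕ

def cellStep (v w : WSt) : Prop :=
  w = (v.1, v.2.1 + 1, v.2.2 + 1) ∨
  (1 ≤ v.2.2 ∧ w = (v.1, v.2.1, v.2.2 - 1)) ∨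
  (1 ≤ v.2.1 ∧ w = (v.1, v.2.1 - 1, v.2.2)) ∨
  (v.2.1 = 0 ∧ w = (v.1 + 1, v.2.2, 0)) ∨
  (v.2.2 = 0 ∧ w = (v.1 - 1, 0, v.2.1 + 1))

def vertStep (v w : WSt) : Prop :=
  w = (v.1, v.2.1 + 1, v.2.2 + 1) ∨
  (1 ≤ v.2.2 ∧ w = (v.1, v.2.1, v.2.2 - 1)) ∨
  (1 ≤ v.2.1 ∧ w = (v.1, v.2.1 - 1, v.2.2)) ∨
  (v.2.1 = 0 ∧ 1 ≤ v.2.2 ∧ w = (v.1 + 1, v.2.2 - 1, 0)) ∨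
  (v.2.2 = 0 ∧ w = (v.1 - 1, 0, v.2.1 + 2))

def pathCount (step : WSt → WSt → Prop) (n : ℕ) (v : WSt) : ℕ :=
  Nat.card {p : Fin (n + 1) → WSt //
    p 0 = ((0 : ℤ), 0, 0) ∧ p (Fin.last n) = v ∧
    ∀ i : Fin n, step (p i.castSucc) (p i.succ)}

/-- number of cell-centred excursions of length `n` with winding angle `2πk/3` -/
def eCell (n : ℕ) (k : ℤ) : ℕ := pathCount cellStep n (k, 0, 0)

/-- number of vertex-centred walks of length `n` with winding angle `2πk/3` -/
def eVert (n : ℕ) (k : ℤ) : ℕ := pathCount vertStep n (k, 0, 0)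

/-- The series `T_k(u,q)`. -/
def Tk (k : ℕ) (u q : ℂ) : ℂ :=
  ∑' n : ℕ, (-1 : ℂ) ^ n * ((2 * n + 1 : ℕ) : ℂ) ^ k * q ^ (n * (n + 1) / 2) *
    (u ^ (n + 1) - (-1 : ℂ) ^ k * u ^ (-(n : ℤ)))

/-- Jacobi theta function θ₁₁. -/
def jTheta (z τ : ℂ) : ℂ :=
  ∑' n : ℤ, (-1 : ℂ) ^ n *
    Complex.exp (((2 * (n : ℂ) + 1) / 2) ^ 2 * Complex.I * (Real.pi : ℂ) * τ +
      (2 * (n : ℂ) + 1) * Complex.I * z)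

/-- derivative of θ with respect to z -/
def jTheta' (z τ : ℂ) : ℂ := deriv (fun w => jTheta w τ) z


/-- The three admissible targets of a step from a given state. -/
def cellTargets : WSt → Finset WSt
  | (k, 0, 0) => {(k, 1, 1), (k + 1, 0, 0), (k - 1, 0, 1)}
  | (k, 0, b + 1) => {(k, 1, b + 2), (k, 0, b), (k + 1, b + 1, 0)}
  | (k, a + 1, 0) => {(k, a + 2, 1), (k, a, 0), (k - 1, 0, a + 2)}
  | (k, a + 1, b + 1) => {(k, a + 2, b + 2), (k, a + 1, b), (k, a, b + 1)}

theorem mem_cellTargets (v w : WSt) : w ∈ cellTargets v ↔ cellStep v w := by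
  obtain ⟨k, a, b⟩ := v
  rcases a with - | a <;> rcases b with - | b <;> simp [cellTargets, cellStep]

/-- The set of paths of length `n` from the origin. -/
def cellPaths : (n : ℕ) → Finset (Fin (n + 1) → WSt)
  | 0 => {fun _ => (0, 0, 0)}
  | n + 1 => (cellPaths n).biUnion fun p =>
      (cellTargets (p (Fin.last n))).image fun w => (Fin.snoc p w : Fin (n + 2) → WSt)

theorem mem_cellPaths (n : ℕ) (p : Fin (n + 1) → WSt) :
    p ∈ cellPaths n ↔ p 0 = (0, 0, 0) ∧ ∀ i : Fin n, cellStep (p i.castSucc) (p i.succ) := by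
  induction n with
  | zero =>
    simp only [cellPaths, Finset.mem_singleton, IsEmpty.forall_iff, and_true]
    exact ⟨fun h => by rw [h],
      fun h => funext fun i => by rw [show i = 0 from Fin.ext (by omega), h]⟩
  | succ n ih =>
    simp only [cellPaths, Finset.mem_biUnion, Finset.mem_image, ih, mem_cellTargets]
    constructor
    · rintro ⟨q, ⟨h0, hq⟩, w, hw, rfl⟩
      refine ⟨?_, fun i => ?_⟩
      · rw [← Fin.castSucc_zero, Fin.snoc_castSucc, h0]
      · refine Fin.lastCases ?_ (fun j => ?_) i
        · rwa [Fin.succ_last, Fin.snoc_last, Fin.snoc_castSucc]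
        · rw [Fin.succ_castSucc, Fin.snoc_castSucc, Fin.snoc_castSucc]
          exact hq j
    · rintro ⟨h0, hp⟩
      refine ⟨Fin.init p, ⟨h0, fun i => ?_⟩, p (Fin.last _), ?_, Fin.snoc_init_self p⟩
      · have := hp i.castSucc
        rwa [Fin.succ_castSucc] at this
      · exact hp (Fin.last n)

theorem sum_cellPaths_succ {M : Type*} [AddCommMonoid M] (n : ℕ) (f : WSt → M) :
    ∑ p ∈ cellPaths (n + 1), f (p (Fin.last _)) =
      ∑ p ∈ cellPaths n, ∑ w ∈ cellTargets (p (Fin.last _)), f w := by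
  have hinj : ∀ (p q : Fin (n + 1) → WSt) (v w : WSt),
      (Fin.snoc p v : Fin (n + 2) → WSt) = Fin.snoc q w → p = q ∧ v = w :=
    fun p q v w h => Fin.snoc_inj.1 h
  rw [cellPaths, Finset.sum_biUnion]
  · refine Finset.sum_congr rfl fun p _ => ?_
    rw [Finset.sum_image fun v _ w _ h => (hinj _ _ _ _ h).2]
    simp
  · intro p _ q _ hpq
    rw [Function.onFun, Finset.disjoint_left]
    intro r hr hr'
    obtain ⟨v, -, rfl⟩ := Finset.mem_image.1 hr
    obtain ⟨w, -, hw⟩ := Finset.mem_image.1 hr'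
    exact hpq (hinj _ _ _ _ hw).1.symm

theorem pathCount_cellStep (n : ℕ) (v : WSt) :
    pathCount cellStep n v = ((cellPaths n).filter fun p => p (Fin.last n) = v).card := by
  rw [pathCount]
  refine Nat.subtype_card _ fun p => ?_
  simp only [Finset.mem_filter, mem_cellPaths]
  tauto

/-- The transfer operator on weighted positions in the wedge. -/
def wedgeTransfer (s : ℂ) : (ℕ × ℕ →₀ ℂ) →ₗ[ℂ] (ℕ × ℕ →₀ ℂ) :=
  Finsupp.linearCombination ℂ fun
    | (0, 0) => .single (1, 1) 1 + .single (0, 0) s + .single (0, 1) s⁻¹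
    | (0, b + 1) => .single (1, b + 2) 1 + .single (0, b) 1 + .single (b + 1, 0) s
    | (a + 1, 0) => .single (a + 2, 1) 1 + .single (a, 0) 1 + .single (0, a + 2) s⁻¹
    | (a + 1, b + 1) => .single (a + 2, b + 2) 1 + .single (a + 1, b) 1 + .single (a, b + 1) 1

/-- Positions in the wedge after `n` steps, weighted by `s` to the power of the winding index. -/
def wedgeWeight (s : ℂ) (n : ℕ) : ℕ × ℕ →₀ ℂ :=
  ∑ p ∈ cellPaths n, .single (p (Fin.last n)).2 (s ^ (p (Fin.last n)).1)

theorem wedgeWeight_zero (s : ℂ) : wedgeWeight s 0 = .single (0, 0) 1 := by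
  simp [wedgeWeight, cellPaths]

theorem wedgeWeight_succ {s : ℂ} (hs : s ≠ 0) (n : ℕ) :
    wedgeWeight s (n + 1) = wedgeTransfer s (wedgeWeight s n) := by
  rw [wedgeWeight, sum_cellPaths_succ n fun v => Finsupp.single v.2 (s ^ v.1), wedgeWeight,
    map_sum]
  refine Finset.sum_congr rfl fun p _ => ?_
  obtain ⟨k, a, b⟩ := p (Fin.last n)
  have h1 : s ^ (k + 1) = s ^ k * s := zpow_add_one₀ hs k
  have h2 : s ^ (k - 1) = s ^ k * s⁻¹ := zpow_sub_one₀ hs k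
  rcases a with - | a <;> rcases b with - | b <;>
    simp [cellTargets, wedgeTransfer, Finset.sum_insert, h1, h2, add_assoc]

theorem wedgeWeight_apply_zero (s : ℂ) (n : ℕ) :
    wedgeWeight s n (0, 0) = ∑' k : ℤ, (eCell n k : ℂ) * s ^ k := by
  rw [tsum_eq_sum (s := (cellPaths n).image fun p => (p (Fin.last n)).1)]
  · simp only [eCell, pathCount_cellStep, wedgeWeight, Finsupp.coe_finsetSum, Finset.sum_apply]
    rw [← Finset.sum_fiberwise_of_maps_to (t := (cellPaths n).image fun p => (p (Fin.last n)).1)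
      (g := fun p => (p (Fin.last n)).1) (fun p hp => Finset.mem_image_of_mem _ hp)]
    refine Finset.sum_congr rfl fun k _ => ?_
    rw [← nsmul_eq_mul, ← Finset.sum_const, Finset.sum_filter, Finset.sum_filter]
    refine Finset.sum_congr rfl fun p _ => ?_
    obtain ⟨k', x⟩ := p (Fin.last n)
    by_cases hk : k' = k <;> by_cases hx : x = (0, 0) <;> simp [hk, hx]
  · intro k hk
    rw [eCell, pathCount_cellStep, Finset.card_eq_zero.2, Nat.cast_zero, zero_mul]
    refine Finset.filter_eq_empty_iff.2 fun p hp h => hk (Finset.mem_image.2 ⟨p, hp, ?_⟩)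
    rw [h]

section
variable {S : Type*} [CommRing S] [Algebra ℂ S]

/-- The generating polynomial of the weighted positions in the wedge. -/
def wedgeEval (x y : S) : (ℕ × ℕ →₀ ℂ) →ₗ[ℂ] S :=
  Finsupp.linearCombination ℂ fun p => x ^ p.1 * y ^ p.2

/-- The generating polynomial of the weighted positions on the first axis of the wedge. -/
def wedgeEvalFst (x : S) : (ℕ × ℕ →₀ ℂ) →ₗ[ℂ] S :=
  Finsupp.linearCombination ℂ fun p => if p.2 = 0 then x ^ p.1 else 0

/-- The generating polynomial of the weighted positions on the second axis of the wedge. -/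
def wedgeEvalSnd (x : S) : (ℕ × ℕ →₀ ℂ) →ₗ[ℂ] S :=
  Finsupp.linearCombination ℂ fun p => if p.1 = 0 then x ^ p.2 else 0

theorem wedgeEval_transfer (s : ℂ) (x y : S) (q : ℕ × ℕ →₀ ℂ) :
    x * y * wedgeEval x y (wedgeTransfer s q) = (x ^ 2 * y ^ 2 + x + y) * wedgeEval x y q -
      x * wedgeEvalFst x q - y * wedgeEvalSnd y q + algebraMap ℂ S s * x * y * wedgeEvalSnd x q +
      algebraMap ℂ S s⁻¹ * x * y ^ 2 * wedgeEvalFst y q := by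
  induction q using Finsupp.induction_linear with
  | zero => simp
  | add f g hf hg =>
    simp only [map_add, mul_add]
    linear_combination hf + hg
  | single p c =>
    obtain ⟨a, b⟩ := p
    rcases a with - | a <;> rcases b with - | b <;>
    · simp [wedgeEval, wedgeEvalFst, wedgeEvalSnd, wedgeTransfer, Algebra.smul_def,
        -Finsupp.single_mul]
      ring


open scoped PowerSeries in
theorem mk_pow_mul_eq {R : Type*} [CommRing R] [Algebra ℂ R] (t : R) (f g : ℕ → R) (h : ℕ → ℂ)
    (hfg : ∀ a, f a = algebraMap ℂ R (h a) + t * g a) :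
    (PowerSeries.mk fun a => t ^ a * f a) = PowerSeries.mk (fun a => t ^ a * algebraMap ℂ R (h a)) +
      PowerSeries.C t * PowerSeries.mk fun a => t ^ a * g a := by
  ext1 a
  simp only [map_add, PowerSeries.coeff_C_mul, PowerSeries.coeff_mk, hfg]
  ring

open scoped PowerSeries in
theorem smul_C_mul_X_pow_eq_mk {R : Type*} [CommRing R] [Algebra ℂ R] (t : R) (c : ℂ) (a : ℕ) :
    c • (PowerSeries.C t * PowerSeries.X : R⟦X⟧) ^ a =
      PowerSeries.mk fun n => if n = a then t ^ n * algebraMap ℂ R c else 0 := by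
  ext1 n
  rw [PowerSeries.coeff_smul, mul_pow, ← map_pow, PowerSeries.coeff_C_mul, PowerSeries.coeff_X_pow,
    PowerSeries.coeff_mk, Algebra.smul_def]
  split_ifs with h
  · rw [h]
    ring
  · simp

open scoped PowerSeries in
theorem wedgeEvalFst_eq_mk {R : Type*} [CommRing R] [Algebra ℂ R] (t : R) (q : ℕ × ℕ →₀ ℂ) :
    wedgeEvalFst (PowerSeries.C t * PowerSeries.X : R⟦X⟧) q =
      PowerSeries.mk fun a => t ^ a * algebraMap ℂ R (q (a, 0)) := by
  induction q using Finsupp.induction_linear with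
  | zero => ext1; simp
  | add f g hf hg =>
    rw [map_add, hf, hg]
    ext1
    simp [mul_add]
  | single p c =>
    obtain ⟨a, b⟩ := p
    ext1 n
    rcases eq_or_ne b 0 with rfl | hb
    · rw [wedgeEvalFst, Finsupp.linearCombination_single, if_pos rfl, smul_C_mul_X_pow_eq_mk]
      by_cases hn : n = a
      · simp [hn]
      · simp [hn]
    · simp [wedgeEvalFst, hb]

open scoped PowerSeries in
theorem wedgeEvalSnd_eq_mk {R : Type*} [CommRing R] [Algebra ℂ R] (t : R) (q : ℕ × ℕ →₀ ℂ) :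
    wedgeEvalSnd (PowerSeries.C t * PowerSeries.X : R⟦X⟧) q =
      PowerSeries.mk fun a => t ^ a * algebraMap ℂ R (q (0, a)) := by
  induction q using Finsupp.induction_linear with
  | zero => ext1; simp
  | add f g hf hg =>
    rw [map_add, hf, hg]
    ext1
    simp [mul_add]
  | single p c =>
    obtain ⟨b, a⟩ := p
    ext1 n
    rcases eq_or_ne b 0 with rfl | hb
    · rw [wedgeEvalSnd, Finsupp.linearCombination_single, if_pos rfl, smul_C_mul_X_pow_eq_mk]
      by_cases hn : n = a
      · simp [hn]
      · simp [hn]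
    · simp [wedgeEvalSnd, hb]

open scoped PowerSeries in
theorem map_wedgeEvalFst {S S' : Type*} [CommRing S] [Algebra ℂ S] [CommRing S'] [Algebra ℂ S']
    (φ : S →ₐ[ℂ] S') (x : S) (q : ℕ × ℕ →₀ ℂ) :
    φ (wedgeEvalFst x q) = wedgeEvalFst (φ x) q := by
  simp only [wedgeEvalFst, Finsupp.linearCombination_apply, Finsupp.sum, map_sum, map_smul]
  refine Finset.sum_congr rfl fun p _ => ?_
  split_ifs <;> simp

open scoped PowerSeries in
theorem map_wedgeEvalSnd {S S' : Type*} [CommRing S] [Algebra ℂ S] [CommRing S'] [Algebra ℂ S']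
    (φ : S →ₐ[ℂ] S') (x : S) (q : ℕ × ℕ →₀ ℂ) :
    φ (wedgeEvalSnd x q) = wedgeEvalSnd (φ x) q := by
  simp only [wedgeEvalSnd, Finsupp.linearCombination_apply, Finsupp.sum, map_sum, map_smul]
  refine Finset.sum_congr rfl fun p _ => ?_
  split_ifs <;> simp

open scoped PowerSeries in
/-- The functional equation of the walks, restricted to the kernel curve. -/
theorem wedge_kernel_equation {R : Type*} [CommRing R] [IsDomain R] [Algebra ℂ R] {t : R}
    (ht : t ≠ 0) (hsep : ∀ r : R, (∀ N, t ^ N ∣ r) → r = 0) {s : ℂ} (hs : s ≠ 0)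
    (ι : R⟦X⟧ →ₐ[R] R⟦X⟧)
    (hι : PowerSeries.X * ι PowerSeries.X = PowerSeries.X + ι PowerSeries.X +
      PowerSeries.C t ^ 3 * PowerSeries.X ^ 2 * ι PowerSeries.X ^ 2) (f g : ℕ → ℕ → R)
    (hf : ∀ N a, f N a = algebraMap ℂ R (wedgeWeight s N (a, 0)) + t * f (N + 1) a)
    (hg : ∀ N a, g N a = algebraMap ℂ R (wedgeWeight s N (0, a)) + t * g (N + 1) a) :
    PowerSeries.X * ι PowerSeries.X =
      PowerSeries.X * PowerSeries.mk (fun a => t ^ a * f 0 a) +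
      ι PowerSeries.X * ι (PowerSeries.mk fun a => t ^ a * g 0 a) -
      algebraMap ℂ R⟦X⟧ s * PowerSeries.C t * PowerSeries.X * ι PowerSeries.X *
        PowerSeries.mk (fun a => t ^ a * g 0 a) -
      algebraMap ℂ R⟦X⟧ s⁻¹ * PowerSeries.C t ^ 2 * PowerSeries.X * ι PowerSeries.X ^ 2 *
        ι (PowerSeries.mk fun a => t ^ a * f 0 a) := by
  have hC : ∀ r, ι (PowerSeries.C r) = PowerSeries.C r := ι.commutes
  set x : R⟦X⟧ := PowerSeries.C t * PowerSeries.X with hx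
  set y : R⟦X⟧ := PowerSeries.C t * ι PowerSeries.X with hy
  have hιx : ι x = y := by rw [hx, map_mul, hC]
  let A : ℕ → R⟦X⟧ := fun N => PowerSeries.mk fun a => t ^ a * f N a
  let B : ℕ → R⟦X⟧ := fun N => PowerSeries.mk fun a => t ^ a * g N a
  have hA : ∀ N, A N = wedgeEvalFst x (wedgeWeight s N) + PowerSeries.C t * A (N + 1) := fun N => by
    rw [hx, wedgeEvalFst_eq_mk]
    exact mk_pow_mul_eq t _ _ _ (hf N)
  have hB : ∀ N, B N = wedgeEvalSnd x (wedgeWeight s N) + PowerSeries.C t * B (N + 1) := fun N => by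
    rw [hx, wedgeEvalSnd_eq_mk]
    exact mk_pow_mul_eq t _ _ _ (hg N)
  have hιA : ∀ N, ι (A N) = wedgeEvalFst y (wedgeWeight s N) + PowerSeries.C t * ι (A (N + 1)) :=
    fun N => by
      have := map_wedgeEvalFst (ι.restrictScalars ℂ) x (wedgeWeight s N)
      rw [AlgHom.coe_restrictScalars', hιx] at this
      rw [hA N, map_add, map_mul, hC, this]
  have hιB : ∀ N, ι (B N) = wedgeEvalSnd y (wedgeWeight s N) + PowerSeries.C t * ι (B (N + 1)) :=
    fun N => by
      have := map_wedgeEvalSnd (ι.restrictScalars ℂ) x (wedgeWeight s N)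
      rw [AlgHom.coe_restrictScalars', hιx] at this
      rw [hB N, map_add, map_mul, hC, this]
  let σ := algebraMap ℂ R⟦X⟧ s
  let τ := algebraMap ℂ R⟦X⟧ s⁻¹
  let Φ : ℕ → R⟦X⟧ := fun N => x * y * wedgeEval x y (wedgeWeight s N) - PowerSeries.C t *
    (x * A N + y * ι (B N) - σ * x * y * B N - τ * x * y ^ 2 * ι (A N))
  have hk : x * y = PowerSeries.C t * (x ^ 2 * y ^ 2 + x + y) := by
    rw [hx, hy]
    linear_combination PowerSeries.C t ^ 2 * hι
  have hΦ : ∀ N, Φ N = PowerSeries.C t * Φ (N + 1) := fun N => by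
    have h1 := wedgeEval_transfer s x y (wedgeWeight s N)
    rw [← wedgeWeight_succ hs] at h1
    simp only [Φ, σ, τ]
    linear_combination (-PowerSeries.C t) * h1 + wedgeEval x y (wedgeWeight s N) * hk -
      PowerSeries.C t * x * hA N - PowerSeries.C t * y * hιB N +
      PowerSeries.C t * algebraMap ℂ R⟦X⟧ s * x * y * hB N +
      PowerSeries.C t * algebraMap ℂ R⟦X⟧ s⁻¹ * x * y ^ 2 * hιA N
  have hΦN : ∀ N, Φ 0 = PowerSeries.C t ^ N * Φ N := fun N => by
    induction N with
    | zero => simp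
    | succ N ih => rw [ih, hΦ N, pow_succ, mul_assoc]
  have hΦ0 : Φ 0 = 0 := by
    ext a
    refine hsep _ fun N => ?_
    rw [hΦN N, ← map_pow, PowerSeries.coeff_C_mul]
    exact dvd_mul_right _ _
  have hP : wedgeEval x y (wedgeWeight s 0) = 1 := by
    rw [wedgeWeight_zero]
    simp [wedgeEval]
  have hCt : PowerSeries.C t ≠ 0 := (map_ne_zero_iff _ PowerSeries.C_injective).2 ht
  apply mul_left_cancel₀ (pow_ne_zero 2 hCt)
  simp only [Φ, hP, A, B, σ, τ] at hΦ0
  rw [hx, hy] at hΦ0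
  linear_combination hΦ0
end

section
variable {K : Type*} [CommRing K] (z u w wi p g : K)

theorem kernel_mul_eq (h : w * wi = 1) (hu : u = 1 - wi - z ^ 3 * w) :
    (-(z * w) * p - g) * (p + z ^ 2 * w * g) * wi =
      -(z * p ^ 2 + (1 - u) * p * g + z ^ 2 * g ^ 2) := by
  subst hu
  grind

theorem kernel_cube_add_cube_eq (h : w * wi = 1) (hu : u = 1 - wi - z ^ 3 * w) :
    (-(z * w) * p - g) ^ 3 * wi ^ 2 + -((p + z ^ 2 * w * g) ^ 3 * wi) =
      -(1 - u) * p ^ 3 - 6 * z ^ 2 * p ^ 2 * g - 3 * z * (1 - u) * p * g ^ 2 +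
        (2 * z ^ 3 - (1 - u) ^ 2) * g ^ 3 := by
  subst hu
  grind

theorem kernel_cube_sub_cube_eq (h : w * wi = 1) (hu : u = 1 - wi - z ^ 3 * w) :
    (-(z * w) * p - g) ^ 3 * wi ^ 2 - -((p + z ^ 2 * w * g) ^ 3 * wi) =
      -wi * (z ^ 3 * w ^ 2 - 1) * (p ^ 3 - 3 * z * p * g ^ 2 - (1 - u) * g ^ 3) := by
  subst hu
  grind

/-- The square root of the homogenised `kernelCubic`, as an element of the kernel curve. -/
def kernelRoot (z w wi : K) : K :=
  (1 + w) * (z ^ 3 * w ^ 2 - 1) * (1 + z ^ 3 * w) * wi ^ 2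

theorem kernelRoot_mul_eq (h : w * wi = 1) (hu : u = 1 - wi - z ^ 3 * w) :
    kernelRoot z w wi * (-wi * (z ^ 3 * w ^ 2 - 1)) =
      -(2 - u + z ^ 3) * ((1 - u) ^ 2 - 4 * z ^ 3) := by
  subst hu
  rw [kernelRoot]
  grind

theorem kernelRoot_sq_eq (t : K) (h : w * wi = 1) (hu : u = 1 - wi - (t * u) ^ 3 * w) :
    kernelRoot (t * u) w wi ^ 2 = -4 * (u - 1 + (t * u) ^ 3) ^ 3 +
      u ^ 2 * (u - 1 + (t * u) ^ 3) ^ 2 + 18 * t ^ 3 * u ^ 4 * (u - 1 + (t * u) ^ 3) -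
      4 * t ^ 3 * u ^ 6 - 27 * t ^ 6 * u ^ 6 := by
  have key : kernelRoot (t * u) w wi ^ 2 =
      (2 - u + (t * u) ^ 3) ^ 2 * ((1 - u) ^ 2 - 4 * (t * u) ^ 3) := by
    generalize t * u = z at hu
    subst hu
    rw [kernelRoot]
    grind
  rw [key]
  ring
end

noncomputable section
open Polynomial
/-- The derivation of `A[X]` acting on coefficients. -/
def coeffDerivation {R A : Type*} [CommRing R] [CommRing A] [Algebra R A] (D : Derivation R A A) :
    Derivation R A[X] A[X] :=
  PolynomialModule.equivPolynomialSelf.compDer D.mapCoeffs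

theorem coeff_coeffDerivation {R A : Type*} [CommRing R] [CommRing A] [Algebra R A]
    (D : Derivation R A A) (p : A[X]) (n : ℕ) :
    (coeffDerivation D p).coeff n = D (p.coeff n) := rfl

theorem natDegree_coeffDerivation_le {R A : Type*} [CommRing R] [CommRing A] [Algebra R A]
    (D : Derivation R A A) (p : A[X]) : (coeffDerivation D p).natDegree ≤ p.natDegree := by
  rw [natDegree_le_iff_coeff_eq_zero]
  intro n hn
  rw [coeff_coeffDerivation, coeff_eq_zero_of_natDegree_lt hn, map_zero]

theorem pell_derivation_eq_zero {R L : Type*} [CommRing R] [Field L] [CharZero L] [Algebra R L[X]]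
    (D : Derivation R L[X] L[X]) (hdeg : ∀ p, (D p).natDegree ≤ p.natDegree)
    {d l : L[X]} (hd : Squarefree d) (hD : D d = 0) (hl : l.natDegree = 1) {b : L}
    (hb : D l = C b) (m : ℕ) :
    ∀ S r : L[X], r ≠ 0 → S ^ 2 - d * r ^ 2 = 4 * l ^ m → 2 * S.natDegree ≤ m →
      2 * r.natDegree + 3 ≤ m → D l = 0 ∧ D S = 0 ∧ D r = 0 := by
  have hlp : Prime l := by
    have : l.degree = 1 := (degree_eq_iff_natDegree_eq_of_pos one_pos).2 hl
    exact prime_of_degree_eq_one this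
  induction m using Nat.strong_induction_on with
  | _ m ih =>
  intro S r hr h hS hr3
  obtain ⟨k, rfl⟩ : ∃ k, m = k + 3 := ⟨m - 3, by omega⟩
  by_cases hlS : l ∣ S
  · obtain ⟨S₁, rfl⟩ := hlS
    by_cases hlr : l ∣ r
    · obtain ⟨r₁, rfl⟩ := hlr
      have hr₁ : r₁ ≠ 0 := right_ne_zero_of_mul hr
      have h1 : S₁ ^ 2 - d * r₁ ^ 2 = 4 * l ^ (k + 1) := by
        apply mul_left_cancel₀ (pow_ne_zero 2 hlp.ne_zero)
        linear_combination h
      have hrd : (l * r₁).natDegree = 1 + r₁.natDegree := by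
        rw [natDegree_mul hlp.ne_zero hr₁, hl]
      have hSd : 2 * S₁.natDegree ≤ k + 1 := by
        by_cases hS₁ : S₁ = 0
        · simp [hS₁]
        · rw [natDegree_mul hlp.ne_zero hS₁, hl] at hS
          omega
      obtain ⟨e1, e2, e3⟩ := ih (k + 1) (by omega) S₁ r₁ hr₁ h1 hSd (by omega)
      simp [e1, e2, e3]
    · exfalso
      have h1 : l ∣ d * r ^ 2 := ⟨l * S₁ ^ 2 - 4 * l ^ (k + 2), by linear_combination -h⟩
      obtain ⟨d₁, rfl⟩ := (hlp.dvd_or_dvd h1).resolve_right fun h2 => hlr (hlp.dvd_of_dvd_pow h2)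
      have h2 : l ∣ d₁ * r ^ 2 := ⟨S₁ ^ 2 - 4 * l ^ (k + 1), by
        apply mul_left_cancel₀ hlp.ne_zero
        linear_combination -h⟩
      have h3 := (hlp.dvd_or_dvd h2).resolve_right fun h2 => hlr (hlp.dvd_of_dvd_pow h2)
      exact hlp.not_isUnit (hd l (mul_dvd_mul_left l h3))
  · have hDh := congrArg D h
    have h4 : D (4 : L[X]) = 0 := by exact_mod_cast D.map_natCast 4
    simp only [map_sub, Derivation.leibniz, Derivation.leibniz_pow, hD, h4, smul_eq_mul,
      nsmul_eq_mul] at hDh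
    push_cast at hDh
    have h2 : (2 : L[X]) ≠ 0 := two_ne_zero
    have hW : S * (S * D r - D S * r) =
        l ^ (k + 2) * (4 * l * D r - 2 * (k + 3) * D l * r) := by
      apply mul_left_cancel₀ h2
      linear_combination 2 * D r * h - r * hDh
    have hco : IsCoprime (l ^ (k + 2)) S :=
      IsCoprime.pow_left ((hlp.irreducible.coprime_iff_not_dvd).2 hlS)
    have hdvd : l ^ (k + 2) ∣ S * D r - D S * r := hco.dvd_of_dvd_mul_left ⟨_, hW⟩
    have hW0 : S * D r - D S * r = 0 := by
      by_contra hne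
      have e1 := natDegree_le_of_dvd hdvd hne
      rw [natDegree_pow, hl] at e1
      have e2 : (S * D r - D S * r).natDegree ≤ S.natDegree + r.natDegree :=
        (natDegree_sub_le_of_le (natDegree_mul_le_of_le le_rfl (hdeg r))
          (natDegree_mul_le_of_le (hdeg S) le_rfl)).trans (max_self _).le
      omega
    rw [hW0, mul_zero, eq_comm, mul_eq_zero] at hW
    have h5 := hW.resolve_left (pow_ne_zero _ hlp.ne_zero)
    have hb0 : b = 0 := by
      by_contra hb0
      have hk : (2 * (k + 3) * b : L) ≠ 0 := by
        have : ((k + 3 : ℕ) : L) ≠ 0 := by exact_mod_cast (by omega : k + 3 ≠ 0)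
        push_cast at this
        exact mul_ne_zero (mul_ne_zero two_ne_zero this) hb0
      have h6 : r = l * (C ((2 * (k + 3) * b)⁻¹) * (4 * D r)) := by
        have : C ((2 * (k + 3) * b)⁻¹) * C (2 * (k + 3) * b) = 1 := by
          rw [← C_mul, inv_mul_cancel₀ hk, C_1]
        rw [hb] at h5
        have h7 : (C (2 * (k + 3) * b) : L[X]) = 2 * (k + 3) * C b := by
          simp [map_ofNat]
        rw [h7] at this
        linear_combination -C ((2 * (k + 3) * b)⁻¹) * h5 - r * this
      obtain ⟨r₁, rfl⟩ : l ∣ r := ⟨_, h6⟩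
      refine hlS (hlp.dvd_of_dvd_pow (n := 2) ⟨4 * l ^ (k + 2) + d * l * r₁ ^ 2, ?_⟩)
      linear_combination h
    rw [hb, hb0, C_0] at h5
    have hr' : D r = 0 := by
      have : 4 * l * D r = 0 := by linear_combination h5
      have h4 : (4 : L[X]) ≠ 0 := OfNat.ofNat_ne_zero 4
      exact (mul_eq_zero.1 this).resolve_left (mul_ne_zero h4 hlp.ne_zero)
    refine ⟨by rw [hb, hb0, C_0], ?_, hr'⟩
    rw [hr', mul_zero, zero_sub, neg_eq_zero, mul_eq_zero] at hW0
    exact hW0.resolve_right hr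
end

section
theorem RingHom.exists_section_of_formallySmooth {R A B : Type*} [CommRing R] [CommRing A]
    [CommRing B] (f : R →+* A) (h : R →+* B) (g : B →+* A) (hf : f.FormallySmooth)
    (hgh : g.comp h = f) (hg : Function.Surjective g) (hn : IsNilpotent (RingHom.ker g)) :
    ∃ σ : A →+* B, (∀ x, g (σ x) = x) ∧ ∀ x, σ (f x) = h x := by
  algebraize [f, h]
  let g' : B →ₐ[R] A := { g with commutes' := fun r => DFunLike.congr_fun hgh r }
  refine ⟨(Algebra.FormallySmooth.liftOfSurjective (AlgHom.id R A) g' hg hn).toRingHom,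
    fun x => ?_, fun x => ?_⟩
  · exact Algebra.FormallySmooth.liftOfSurjective_apply (AlgHom.id R A) g' hg hn x
  · exact (Algebra.FormallySmooth.liftOfSurjective (AlgHom.id R A) g' hg hn).commutes x

theorem Algebra.FormallySmooth.of_charZero (K L : Type*) [Field K] [Field L] [CharZero K]
    [Algebra K L] : Algebra.FormallySmooth K L := by
  obtain ⟨ι, x, hx⟩ := exists_isTranscendenceBasis' K L
  have := hx.isAlgebraic_field
  exact .of_algebraicIndependent_of_isSeparable hx.1

theorem AlgebraicIndependent.formallySmooth_aeval {K L ι : Type*} [Field K] [CharZero K] [Field L]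
    [Algebra K L] {x : ι → L} (hx : AlgebraicIndependent K x) :
    (MvPolynomial.aeval x : MvPolynomial ι K →ₐ[K] L).toRingHom.FormallySmooth := by
  let : Algebra (MvPolynomial ι K) L :=
    (MvPolynomial.aeval x : MvPolynomial ι K →ₐ[K] L).toRingHom.toAlgebra
  let F := FractionRing (MvPolynomial ι K)
  have hinj : Function.Injective (algebraMap (MvPolynomial ι K) L) := hx
  let : FaithfulSMul (MvPolynomial ι K) L := (faithfulSMul_iff_algebraMap_injective _ _).2 hinj
  let : Algebra F L := FractionRing.liftAlgebra _ _
  have : IsScalarTower (MvPolynomial ι K) F L := inferInstance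
  have : CharZero F := charZero_of_injective_algebraMap (R := K)
    (((IsFractionRing.injective (MvPolynomial ι K) F)).comp (MvPolynomial.C_injective ι K) :
      Function.Injective ((algebraMap (MvPolynomial ι K) F).comp MvPolynomial.C))
  have h1 : Algebra.FormallySmooth (MvPolynomial ι K) F :=
    .of_isLocalization (nonZeroDivisors _)
  have h2 : Algebra.FormallySmooth F L := .of_charZero F L
  exact Algebra.FormallySmooth.comp _ F L

theorem AlgebraicIndependent.exists_derivation {K L ι : Type*} [Field K] [CharZero K] [Field L]
    [Algebra K L] {x : ι → L} (hx : AlgebraicIndependent K x) (y : ι → L) :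
    ∃ D : Derivation K L L, ∀ i, D (x i) = y i := by
  let h : MvPolynomial ι K →ₐ[K] TrivSqZeroExt L L :=
    MvPolynomial.aeval fun i => (TrivSqZeroExt.inl (x i) + TrivSqZeroExt.inr (y i))
  let g : TrivSqZeroExt L L →ₐ[K] L := TrivSqZeroExt.fstHom K L L
  have hgh : g.toRingHom.comp h.toRingHom =
      (MvPolynomial.aeval x : MvPolynomial ι K →ₐ[K] L).toRingHom := by
    have : g.comp h = MvPolynomial.aeval x := by
      ext i
      simp [g, h]
    rw [← this]
    rfl
  obtain ⟨σ, h1, h2⟩ := RingHom.exists_section_of_formallySmooth _ h.toRingHom g.toRingHom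
    hx.formallySmooth_aeval hgh (fun a => ⟨TrivSqZeroExt.inl a, rfl⟩) ⟨2, by
      rw [pow_two, Submodule.zero_eq_bot, eq_bot_iff, Ideal.mul_le]
      intro a ha b hb
      have ha : a.fst = 0 := ha
      have hb : b.fst = 0 := hb
      rw [Ideal.mem_bot]
      ext <;> simp [ha, hb]⟩
  have h1 : ∀ a, (σ a).fst = a := h1
  have hK : ∀ c : K, σ (algebraMap K L c) = TrivSqZeroExt.inl (algebraMap K L c) := fun c => by
    have := h2 (MvPolynomial.C c)
    simpa [h, TrivSqZeroExt.algebraMap_eq_inl'] using this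
  refine ⟨Derivation.mk' { toFun := fun a => (σ a).snd, map_add' := by simp, map_smul' := ?_ } ?_,
    fun i => ?_⟩
  · intro c a
    rw [Algebra.smul_def, map_mul, hK]
    simp [Algebra.smul_def]
  · intro a b
    simp [h1, mul_comm]
  · have := h2 (MvPolynomial.X i)
    simp only [AlgHom.toRingHom_eq_coe, RingHom.coe_coe, MvPolynomial.aeval_X, h] at this
    simp [this]
end

noncomputable section
open scoped PowerSeries

variable {R k : Type*} [CommRing R] [Field k]

/-- Power series over `R` which are polynomials modulo every power of `t`. -/
def polySubalgebra (t : R) : Subalgebra R R⟦X⟧ where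
  carrier := {f | ∀ N, ∃ P : Polynomial R, PowerSeries.C (t ^ N) ∣ f - (P : R⟦X⟧)}
  mul_mem' := by
    intro f g hf hg N
    obtain ⟨P, hP⟩ := hf N
    obtain ⟨Q, hQ⟩ := hg N
    refine ⟨P * Q, ?_⟩
    rw [Polynomial.coe_mul,
      show f * g - (P : R⟦X⟧) * (Q : R⟦X⟧) = f * (g - Q) + (f - P) * Q by ring]
    exact dvd_add (hQ.mul_left _) (hP.mul_right _)
  add_mem' := by
    intro f g hf hg N
    obtain ⟨P, hP⟩ := hf N
    obtain ⟨Q, hQ⟩ := hg N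
    refine ⟨P + Q, ?_⟩
    rw [Polynomial.coe_add, add_sub_add_comm]
    exact dvd_add hP hQ
  algebraMap_mem' := by
    intro r N
    refine ⟨Polynomial.C r, ?_⟩
    rw [Polynomial.coe_C, ← PowerSeries.algebraMap_eq, sub_self]
    exact dvd_zero _

theorem coe_mem_polySubalgebra (t : R) (P : Polynomial R) :
    (P : R⟦X⟧) ∈ polySubalgebra t := fun _ => ⟨P, by simp⟩

theorem X_mem_polySubalgebra (t : R) : (PowerSeries.X : R⟦X⟧) ∈ polySubalgebra t := by
  simpa using coe_mem_polySubalgebra t Polynomial.X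

theorem C_mem_polySubalgebra (t r : R) : PowerSeries.C r ∈ polySubalgebra t := by
  simpa using coe_mem_polySubalgebra t (Polynomial.C r)

theorem mk_mem_polySubalgebra (t : R) (g : ℕ → R) :
    PowerSeries.mk (fun n => t ^ n * g n) ∈ polySubalgebra t := by
  intro N
  refine ⟨PowerSeries.trunc N (PowerSeries.mk (fun n => t ^ n * g n)),
    PowerSeries.mk (fun n => t ^ (n - N) * (if n < N then 0 else g n)), ?_⟩
  ext1 n
  rw [map_sub, Polynomial.coeff_coe, PowerSeries.coeff_trunc, PowerSeries.coeff_C_mul]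
  simp only [PowerSeries.coeff_mk]
  split_ifs with h
  · simp
  · rw [← mul_assoc, ← pow_add, Nat.add_sub_cancel' (not_lt.1 h), sub_zero]

theorem eq_zero_of_forall_C_pow_dvd {t : R} (hsep : ∀ r : R, (∀ N, t ^ N ∣ r) → r = 0)
    {f : R⟦X⟧} (h : ∀ N, PowerSeries.C (t ^ N) ∣ f) : f = 0 := by
  ext n
  refine hsep _ fun N => ?_
  obtain ⟨g, hg⟩ := h N
  rw [hg, PowerSeries.coeff_C_mul]
  exact dvd_mul_right _ _

theorem C_dvd_of_map_eq_zero {t : R} {ε : R →+* k} (hε : ∀ r, ε r = 0 → t ∣ r) {g : R⟦X⟧}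
    (h : PowerSeries.map ε g = 0) : PowerSeries.C t ∣ g := by
  have : ∀ n, ∃ r, PowerSeries.coeff n g = t * r := fun n => by
    have := congrArg (PowerSeries.coeff n) h
    rw [PowerSeries.coeff_map, map_zero] at this
    exact hε _ this
  choose r hr using this
  refine ⟨PowerSeries.mk r, ?_⟩
  ext1 n
  rw [hr, PowerSeries.coeff_C_mul, PowerSeries.coeff_mk]

theorem exists_C_pow_mul {t : R} {ε : R →+* k} (hε : ∀ r, ε r = 0 → t ∣ r)
    (hsep : ∀ r : R, (∀ N, t ^ N ∣ r) → r = 0) {f : R⟦X⟧} (hf : f ≠ 0) :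
    ∃ (n : ℕ) (g : R⟦X⟧), f = PowerSeries.C (t ^ n) * g ∧ PowerSeries.map ε g ≠ 0 := by
  classical
  have h : ∃ N, ¬ PowerSeries.C (t ^ N) ∣ f := by
    by_contra! h
    exact hf (eq_zero_of_forall_C_pow_dvd hsep h)
  obtain ⟨n, hn⟩ : ∃ n, Nat.find h = n + 1 := Nat.exists_eq_succ_of_ne_zero fun h0 => by
    have := Nat.find_spec h
    rw [h0] at this
    simp at this
  have h1 : PowerSeries.C (t ^ n) ∣ f :=
    not_not.1 (Nat.find_min h (hn ▸ Nat.lt_succ_self n))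
  obtain ⟨g, hg⟩ := h1
  refine ⟨n, g, hg, fun h0 => ?_⟩
  have := Nat.find_spec h
  rw [hn, hg, pow_succ, map_mul] at this
  exact this (mul_dvd_mul_left _ (C_dvd_of_map_eq_zero hε h0))

theorem mem_polySubalgebra_of_C_pow_mul_mem [IsDomain R] {t : R} (ht : t ≠ 0) {n : ℕ} {g : R⟦X⟧}
    (h : PowerSeries.C (t ^ n) * g ∈ polySubalgebra t) : g ∈ polySubalgebra t := by
  intro N
  obtain ⟨P, hP⟩ := h (n + N)
  have hC : (PowerSeries.C (t ^ n)) ≠ 0 :=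
    (map_ne_zero_iff _ PowerSeries.C_injective).2 (pow_ne_zero _ ht)
  have h1 : Polynomial.C (t ^ n) ∣ P := by
    rw [Polynomial.C_dvd_iff_dvd_coeff]
    intro i
    obtain ⟨q, hq⟩ := hP
    rw [pow_add, map_mul, mul_assoc] at hq
    refine ⟨PowerSeries.coeff i g - PowerSeries.coeff i (PowerSeries.C (t ^ N) * q), ?_⟩
    have := congrArg (PowerSeries.coeff i) hq
    rw [map_sub, PowerSeries.coeff_C_mul, PowerSeries.coeff_C_mul, Polynomial.coeff_coe] at this
    linear_combination -this
  obtain ⟨Q, rfl⟩ := h1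
  refine ⟨Q, ?_⟩
  rw [Polynomial.coe_mul, Polynomial.coe_C, ← mul_sub, pow_add, map_mul] at hP
  exact (mul_dvd_mul_iff_left hC).1 hP

theorem exists_eval_one (v₀ : k⟦X⟧) (hv : v₀ * (1 - PowerSeries.X) = -PowerSeries.X)
    (p : Polynomial k) {d : ℕ} (hd : p.natDegree ≤ d) :
    ∃ Q : Polynomial k, (1 - PowerSeries.X) ^ d * Polynomial.aeval v₀ p = (Q : k⟦X⟧) ∧
      Q.eval 1 = p.coeff d * (-1) ^ d := by
  refine ⟨∑ i ∈ Finset.range (d + 1),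
    Polynomial.C (p.coeff i) * (-Polynomial.X) ^ i * (1 - Polynomial.X) ^ (d - i), ?_, ?_⟩
  · rw [Polynomial.aeval_eq_sum_range' (Nat.lt_succ_of_le hd), Finset.mul_sum,
      ← Polynomial.coeToPowerSeries.ringHom_apply, map_sum]
    refine Finset.sum_congr rfl fun i hi => ?_
    have hi : i ≤ d := Nat.le_of_lt_succ (Finset.mem_range.1 hi)
    simp only [Polynomial.coeToPowerSeries.ringHom_apply, Polynomial.coe_mul, Polynomial.coe_pow,
      Polynomial.coe_neg, Polynomial.coe_sub, Polynomial.coe_X, Polynomial.coe_one,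
      Polynomial.coe_C]
    rw [← hv, PowerSeries.smul_eq_C_mul, mul_pow]
    nth_rw 1 [← Nat.sub_add_cancel hi]
    rw [pow_add]
    ring
  · rw [Polynomial.eval_finsetSum, Finset.sum_range_succ, Finset.sum_eq_zero]
    · simp
    · intro i hi
      have : d - i ≠ 0 := by
        have := Finset.mem_range.1 hi
        omega
      simp [this]

/-- A nonzero polynomial `p` with `p(u) = (-1) ^ M (1 - u) ^ M p(-u / (1 - u))` has a nonzero
coefficient at `u ^ (M - 2 j)` for some `j`. -/
theorem exists_coeff_ne_zero_of_invariant (v₀ : k⟦X⟧)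
    (hv : v₀ * (1 - PowerSeries.X) = -PowerSeries.X) (h2 : (2 : k) ≠ 0)
    {p : Polynomial k} (hp : p ≠ 0) {M : ℕ}
    (h : v₀ ^ M * (p : k⟦X⟧) = PowerSeries.X ^ M * Polynomial.aeval v₀ p) :
    ∃ j, 2 * j ≤ M ∧ p.coeff (M - 2 * j) ≠ 0 := by
  have hX : (PowerSeries.X : k⟦X⟧) ≠ 0 := PowerSeries.X_ne_zero
  have hd : p.natDegree ≤ M := by
    by_contra! hlt
    obtain ⟨e, he⟩ := Nat.exists_eq_add_of_lt hlt
    obtain ⟨Q, hQ, hQ1⟩ := exists_eval_one v₀ hv p le_rfl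
    have h1 : ((1 - PowerSeries.X : k⟦X⟧)) ≠ 0 := fun h0 => by
      have := congrArg PowerSeries.constantCoeff h0
      simp at this
    have h3 : (Q : k⟦X⟧) = ((-1) ^ M * (1 - Polynomial.X) ^ (e + 1) * p : Polynomial k) := by
      apply mul_left_cancel₀ (mul_ne_zero (pow_ne_zero M hX) (pow_ne_zero M h1))
      simp only [Polynomial.coe_mul, Polynomial.coe_pow,
        Polynomial.coe_neg, Polynomial.coe_sub, Polynomial.coe_X, Polynomial.coe_one]
      have h4 : (-PowerSeries.X : k⟦X⟧) ^ M = v₀ ^ M * (1 - PowerSeries.X) ^ M := by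
        rw [← mul_pow, hv]
      rw [neg_pow] at h4
      rw [← hQ, he, show M + e + 1 = M + (e + 1) by ring, pow_add]
      linear_combination (-(1 - PowerSeries.X) ^ M * (1 - PowerSeries.X) ^ M *
        (1 - PowerSeries.X) ^ (e + 1)) * h -
        (1 - PowerSeries.X) ^ M * (1 - PowerSeries.X) ^ (e + 1) * (p : k⟦X⟧) * h4
    rw [Polynomial.coe_inj] at h3
    rw [h3] at hQ1
    simp only [Polynomial.eval_mul, Polynomial.eval_pow, Polynomial.eval_sub, Polynomial.eval_one,
      Polynomial.eval_X, sub_self, ne_eq, Nat.succ_ne_zero, not_false_eq_true, zero_pow,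
      mul_zero, zero_mul, Polynomial.coeff_natDegree] at hQ1
    have := mul_ne_zero (Polynomial.leadingCoeff_ne_zero.2 hp)
      (pow_ne_zero p.natDegree (neg_ne_zero.2 (one_ne_zero (α := k))))
    exact this hQ1.symm
  obtain ⟨q, hq, hq0⟩ := Polynomial.exists_eq_pow_rootMultiplicity_mul_and_not_dvd p hp 0
  rw [map_zero, sub_zero] at hq hq0
  rw [Polynomial.X_dvd_iff] at hq0
  set i := p.rootMultiplicity 0
  have hci : p.coeff i = q.coeff 0 := by
    have := Polynomial.coeff_X_pow_mul q i 0
    rwa [← hq, zero_add] at this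
  have hiM : i ≤ M := (Polynomial.le_natDegree_of_ne_zero (hci ▸ hq0)).trans hd
  have hodd : ((-1 : k)) ^ M = (-1) ^ i := by
    obtain ⟨g, hg, hg0⟩ : ∃ g : k⟦X⟧,
        v₀ = -PowerSeries.X * g ∧ PowerSeries.constantCoeff g = 1 := by
      refine ⟨(1 - PowerSeries.X)⁻¹, ?_, by simp⟩
      rw [← hv, mul_assoc, PowerSeries.mul_inv_cancel _ (by simp), mul_one]
    rw [hq] at h
    simp only [map_mul, map_pow, Polynomial.aeval_X, Polynomial.coe_mul, Polynomial.coe_pow,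
      Polynomial.coe_X] at h
    have h5 : (-g) ^ M * (q : k⟦X⟧) = (-g) ^ i * Polynomial.aeval v₀ q := by
      apply mul_left_cancel₀ (mul_ne_zero (pow_ne_zero M hX) (pow_ne_zero i hX))
      have e1 : v₀ ^ M = PowerSeries.X ^ M * (-g) ^ M := by rw [← mul_pow, hg]; ring
      have e2 : v₀ ^ i = PowerSeries.X ^ i * (-g) ^ i := by rw [← mul_pow, hg]; ring
      rw [e1, e2] at h
      linear_combination h
    have h6 := congrArg PowerSeries.constantCoeff h5
    have h7 : PowerSeries.constantCoeff (Polynomial.aeval v₀ q) = q.coeff 0 := by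
      have : PowerSeries.constantCoeff v₀ = 0 := by rw [hg]; simp
      rw [Polynomial.aeval_def, Polynomial.hom_eval₂, this, Polynomial.eval₂_at_zero]
      simp
    simp only [map_mul, map_pow, map_neg, hg0, h7, Polynomial.constantCoeff_coe] at h6
    exact mul_right_cancel₀ hq0 h6
  obtain ⟨e, he⟩ := Nat.exists_eq_add_of_le hiM
  have hev : Even e := by
    rw [he, pow_add] at hodd
    have h8 : (-1 : k) ^ e = 1 := by
      apply mul_left_cancel₀ (pow_ne_zero i (neg_ne_zero.2 (one_ne_zero (α := k))))
      rw [hodd, mul_one]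
    by_contra ho
    rw [Nat.not_even_iff_odd] at ho
    rw [ho.neg_one_pow] at h8
    apply h2
    linear_combination -h8
  obtain ⟨j, hj⟩ := hev
  refine ⟨j, by omega, ?_⟩
  rw [show M - 2 * j = i by omega, hci]
  exact hq0

/-- `f = u ^ M P(c / u ^ 2)` for a polynomial `P` of degree at most `M / 2`. -/
def IsHomogeneousIn (F : Type*) [Field F] [Algebra R⟦X⟧ F] (c : R⟦X⟧)
    (M : ℕ) (f : R⟦X⟧) (P : Polynomial R) : Prop :=
  2 * P.natDegree ≤ M ∧ algebraMap R⟦X⟧ F f = algebraMap R⟦X⟧ F PowerSeries.X ^ M *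
    P.eval₂ ((algebraMap R⟦X⟧ F).comp PowerSeries.C)
      (algebraMap R⟦X⟧ F c / algebraMap R⟦X⟧ F PowerSeries.X ^ 2)

theorem exists_isHomogeneousIn [IsDomain R] {t : R} {ε : R →+* k} (ht : t ≠ 0) (hεt : ε t = 0)
    (hε : ∀ r, ε r = 0 → t ∣ r) (hsep : ∀ r : R, (∀ N, t ^ N ∣ r) → r = 0) (F : Type*) [Field F]
    [Algebra R⟦X⟧ F] [FaithfulSMul R⟦X⟧ F] (h2 : (2 : k) ≠ 0) (ι : R⟦X⟧ →ₐ[R] R⟦X⟧)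
    (hι : PowerSeries.map ε (ι PowerSeries.X) * (1 - PowerSeries.X) = -PowerSeries.X) {c : R⟦X⟧}
    (hc : c ∈ polySubalgebra t) (hιc : ι PowerSeries.X ^ 2 * c = PowerSeries.X ^ 2 * ι c)
    (hc0 : PowerSeries.constantCoeff c = -1)
    {M : ℕ} {f : R⟦X⟧} (hf : f ∈ polySubalgebra t)
    (hιf : ι PowerSeries.X ^ M * f = PowerSeries.X ^ M * ι f) :
    ∃ P, IsHomogeneousIn F c M f P := by
  have key : ∀ J : ℕ, ∀ f ∈ polySubalgebra t,
      ι PowerSeries.X ^ M * f = PowerSeries.X ^ M * ι f →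
      (∀ j, J ≤ j → 2 * j ≤ M → PowerSeries.coeff (M - 2 * j) f = 0) →
      ∃ P, IsHomogeneousIn F c M f P := by
    intro J
    induction J with
    | zero =>
      intro f hf hιf h0
      have : f = 0 := by
        by_contra hne
        obtain ⟨n, g, rfl, hg⟩ := exists_C_pow_mul hε hsep hne
        have hCn : (PowerSeries.C (t ^ n)) ≠ 0 := left_ne_zero_of_mul hne
        obtain ⟨P, q, hP⟩ := mem_polySubalgebra_of_C_pow_mul_mem ht hf 1
        rw [sub_eq_iff_eq_add'] at hP
        have hC : ∀ r, ι (PowerSeries.C r) = PowerSeries.C r := ι.commutes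
        rw [map_mul, hC, mul_left_comm, mul_left_comm (PowerSeries.X ^ M)] at hιf
        have h1 := mul_left_cancel₀ hCn hιf
        have hmP : PowerSeries.map ε (P : R⟦X⟧) =
            (P.map ε : Polynomial k) := by
          ext; simp
        have hmg : PowerSeries.map ε g =
            (P.map ε : Polynomial k) := by
          rw [hP, map_add, hmP, map_mul, PowerSeries.map_C]
          simp [hεt]
        have hεC : (PowerSeries.map ε).comp PowerSeries.C = PowerSeries.C.comp ε := by
          ext1 r
          simp
        have hmιg : PowerSeries.map ε (ι g) = Polynomial.aeval
            (PowerSeries.map ε (ι PowerSeries.X))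
            (P.map ε : Polynomial k) := by
          have e1 : (P : R⟦X⟧) = Polynomial.aeval PowerSeries.X P :=
            Polynomial.eval₂_C_X_eq_coe.symm
          rw [hP, map_add, map_mul, hC, map_add, map_mul, PowerSeries.map_C, e1,
            ← Polynomial.aeval_algHom_apply, Polynomial.aeval_def, Polynomial.hom_eval₂,
            Polynomial.aeval_def, Polynomial.eval₂_map]
          simp [hεt, hεC]
        have h3 := congrArg (PowerSeries.map ε) h1
        rw [map_mul, map_mul, map_pow, map_pow, hmιg, PowerSeries.map_X, hmg] at h3
        obtain ⟨j, hj, hj2⟩ := exists_coeff_ne_zero_of_invariant _ hι h2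
          (fun h0 => hg (by rw [hmg, h0, Polynomial.coe_zero])) h3
        have h4 := h0 j (Nat.zero_le _) hj
        rw [PowerSeries.coeff_C_mul, mul_eq_zero] at h4
        have h5 := h4.resolve_left (pow_ne_zero _ ht)
        apply hj2
        rw [← Polynomial.coeff_coe, ← hmg, PowerSeries.coeff_map, h5, map_zero]
      subst this
      exact ⟨0, by simp [IsHomogeneousIn]⟩
    | succ J ih =>
      intro f hf hιf h0
      by_cases hJ : M < 2 * J
      · exact ih f hf hιf fun j hj hj2 => by omega
      push Not at hJ
      obtain ⟨m, rfl⟩ := Nat.exists_eq_add_of_le hJ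
      obtain ⟨a, ha⟩ : ∃ a : R, a = (-1) ^ J * PowerSeries.coeff m f := ⟨_, rfl⟩
      obtain ⟨P, hP, hPf⟩ := ih (f - PowerSeries.C a * (c ^ J * PowerSeries.X ^ m))
        (sub_mem hf (mul_mem (C_mem_polySubalgebra t a)
          (mul_mem (pow_mem hc J) (pow_mem (X_mem_polySubalgebra t) m)))) (by
          have hC : ∀ r, ι (PowerSeries.C r) = PowerSeries.C r := ι.commutes
          have hcJ : ι PowerSeries.X ^ (2 * J) * c ^ J = PowerSeries.X ^ (2 * J) * ι c ^ J := by
            rw [pow_mul, ← mul_pow, hιc, mul_pow, ← pow_mul]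
          rw [map_sub, map_mul, hC, map_mul, map_pow, map_pow, mul_sub, hιf, mul_sub,
            pow_add, pow_add]
          linear_combination -PowerSeries.C a * ι PowerSeries.X ^ m * PowerSeries.X ^ m * hcJ)
        (by
          intro j hj hj2
          rw [map_sub, PowerSeries.coeff_C_mul, PowerSeries.coeff_mul_X_pow']
          rcases hj.eq_or_lt with rfl | hlt
          · rw [Nat.add_sub_cancel_left, if_pos le_rfl, Nat.sub_self,
              PowerSeries.coeff_zero_eq_constantCoeff_apply, map_pow, hc0, ha, mul_right_comm,
              ← pow_add, Even.neg_one_pow ⟨_, rfl⟩, one_mul, sub_self]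
          · rw [if_neg (by omega), mul_zero, sub_zero]
            exact h0 j hlt hj2)
      refine ⟨P + Polynomial.monomial J a, ?_, ?_⟩
      · have h5 := Polynomial.natDegree_add_le P (Polynomial.monomial J a)
        have h6 := Polynomial.natDegree_monomial_le a (m := J)
        rcases le_max_iff.1 h5 with h7 | h7 <;> omega
      · have hX : algebraMap R⟦X⟧ F PowerSeries.X ≠ 0 :=
          (map_ne_zero_iff _ (FaithfulSMul.algebraMap_injective _ F)).2 PowerSeries.X_ne_zero
        rw [map_sub, sub_eq_iff_eq_add] at hPf
        rw [hPf, Polynomial.eval₂_add, mul_add, Polynomial.eval₂_monomial, map_mul, map_mul,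
          map_pow, map_pow, div_pow, ← pow_mul, pow_add]
        congr 1
        field_simp
        rw [mul_comm, RingHom.comp_apply]
  exact key (M + 1) f hf hιf fun j hj hj2 => by omega
end

noncomputable section
open scoped PowerSeries
variable {R : Type*} [CommRing R]

theorem PowerSeries.exists_quadratic_root (ρ : R⟦X⟧) (hρ : PowerSeries.constantCoeff ρ = 0) :
    ∃ w : R⟦X⟧, w * (1 - PowerSeries.X) = 1 + ρ * w ^ 2 ∧ PowerSeries.constantCoeff w = 1 := by
  obtain ⟨g, hg⟩ : ∃ g : R⟦X⟧, g * (1 - PowerSeries.X) = 1 :=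
    ⟨_, PowerSeries.mk_one_mul_one_sub_eq_one R⟩
  have hs : PowerSeries.HasSubst (ρ * g ^ 2) := PowerSeries.HasSubst.of_constantCoeff_zero' (by
    simp [hρ])
  obtain ⟨c, hc⟩ : ∃ c : R⟦X⟧, c ^ 2 * PowerSeries.X + 1 = c :=
    ⟨PowerSeries.map (Nat.castRingHom R) PowerSeries.catalanSeries, by
      have := congrArg (PowerSeries.map (Nat.castRingHom R))
        PowerSeries.catalanSeries_sq_mul_X_add_one
      simpa using this⟩
  have h1 := congrArg (PowerSeries.substAlgHom (R := R) hs) hc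
  simp only [map_add, map_mul, map_pow, map_one, PowerSeries.substAlgHom_X] at h1
  set d := PowerSeries.substAlgHom (R := R) hs c
  refine ⟨g * d, by linear_combination d * hg - h1, ?_⟩
  have h2 := congrArg PowerSeries.constantCoeff h1
  have h3 := congrArg PowerSeries.constantCoeff hg
  simp only [map_add, map_mul, map_pow, hρ, map_one, map_sub, PowerSeries.constantCoeff_X] at h2 h3
  rw [map_mul, ← h2]
  linear_combination h3

theorem PowerSeries.exists_kernel_involution [IsDomain R] (t : R) :
    ∃ (w : R⟦X⟧) (ι : R⟦X⟧ →ₐ[R] R⟦X⟧), w * ι w = 1 ∧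
      ι w = 1 - PowerSeries.X - (PowerSeries.C t * PowerSeries.X) ^ 3 * w ∧
      ι PowerSeries.X = -PowerSeries.X * w ∧ PowerSeries.constantCoeff w = 1 := by
  obtain ⟨w, hw, hw0⟩ := PowerSeries.exists_quadratic_root
    ((PowerSeries.C t * PowerSeries.X) ^ 3) (by simp)
  have hs : PowerSeries.HasSubst (-PowerSeries.X * w : R⟦X⟧) :=
    PowerSeries.HasSubst.of_constantCoeff_zero' (by simp)
  let ι : R⟦X⟧ →ₐ[R] R⟦X⟧ := PowerSeries.substAlgHom hs
  have hX : ι PowerSeries.X = -PowerSeries.X * w := PowerSeries.substAlgHom_X hs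
  have hC : ι (PowerSeries.C t) = PowerSeries.C t := ι.commutes t
  have hιw := congrArg ι hw
  simp only [map_mul, map_sub, map_one, map_add, map_pow, hX, hC] at hιw
  have h1 : PowerSeries.X * w * ι w = PowerSeries.X := by
    have h2 : (PowerSeries.X * w * ι w - PowerSeries.X) * (-PowerSeries.X * w - 1 -
        PowerSeries.C t ^ 3 * (-PowerSeries.X * w) ^ 2 *
          (PowerSeries.X * w * ι w + PowerSeries.X)) = 0 := by
      linear_combination -PowerSeries.X * w * hιw - PowerSeries.X * hw
    refine sub_eq_zero.1 ((mul_eq_zero.1 h2).resolve_right fun h3 => ?_)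
    have := congrArg PowerSeries.constantCoeff h3
    simp at this
  have h2 : w * ι w = 1 := by
    apply mul_left_cancel₀ (PowerSeries.X_ne_zero (R := R))
    rw [← mul_assoc, h1, mul_one]
  exact ⟨w, ι, h2, by
    linear_combination -ι w * hw + (1 - PowerSeries.X -
      (PowerSeries.C t * PowerSeries.X) ^ 3 * w) * h2, hX, hw0⟩
end

noncomputable section
open Polynomial

theorem PowerSeries.algHom_apply_eq_self {R : Type*} [CommRing R]
    (φ : PowerSeries R →ₐ[R] PowerSeries R)
    (hφ : φ PowerSeries.X = PowerSeries.X) (f : PowerSeries R) : φ f = f := by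
  have hC : ∀ r, φ (PowerSeries.C r) = PowerSeries.C r := φ.commutes
  have key : ∀ n, ∀ f : PowerSeries R, PowerSeries.X ^ n ∣ φ f - f := by
    intro n
    induction n with
    | zero => simp
    | succ n ih =>
      intro f
      obtain ⟨g, hg⟩ : PowerSeries.X ∣ f - PowerSeries.C (PowerSeries.constantCoeff f) :=
        PowerSeries.X_dvd_iff.2 (by simp)
      rw [sub_eq_iff_eq_add] at hg
      obtain ⟨h, hh⟩ := ih g
      refine ⟨h, ?_⟩
      have : φ f = PowerSeries.X * φ g + PowerSeries.C (PowerSeries.constantCoeff f) := by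
        conv_lhs => rw [hg]
        rw [map_add, map_mul, hφ, hC]
      rw [this]
      conv_lhs => rw [hg]
      simp only [map_add, map_mul, PowerSeries.constantCoeff_X, zero_mul, zero_add,
        PowerSeries.constantCoeff_C]
      linear_combination PowerSeries.X * hh
  rw [← sub_eq_zero]
  ext n
  exact PowerSeries.X_pow_dvd_iff.1 (key (n + 1) f) n n.lt_succ_self

theorem Subalgebra.mul_pow_add_mul_pow_mem {R A : Type*} [CommRing R] [CommRing A] [Algebra R A]
    (S : Subalgebra R A) {a b x y : A} (hs : a + b ∈ S) (hp : a * b ∈ S) (h0 : x + y ∈ S)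
    (h1 : x * a + y * b ∈ S) (n : ℕ) : x * a ^ n + y * b ^ n ∈ S := by
  induction n using Nat.strong_induction_on with
  | _ n ih =>
    match n with
    | 0 => simpa using h0
    | 1 => simpa using h1
    | n + 2 =>
      have := S.sub_mem (S.mul_mem hs (ih (n + 1) (by omega))) (S.mul_mem hp (ih n (by omega)))
      convert this using 1
      ring

/-- The cubic whose square root generates the invariants of the kernel curve; here `T = t ^ 3`. -/
def kernelCubic {A : Type*} [CommRing A] (T : A) : A[X] :=
  -4 * X ^ 3 + X ^ 2 + 18 * C T * X - 4 * C T - 27 * C T ^ 2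

theorem squarefree_kernelCubic {L : Type*} [Field L] [CharZero L] {T : L} (hT : T ≠ 0)
    (hT' : 27 * T ≠ 1) : Squarefree (kernelCubic T) := by
  apply Separable.squarefree
  have hd : derivative (kernelCubic T) = -12 * X ^ 2 + 2 * X + 18 * C T := by
    simp only [kernelCubic, derivative_sub, derivative_add, derivative_mul,
      derivative_X, derivative_C, derivative_pow, derivative_neg, derivative_ofNat]
    simp only [map_natCast]
    push_cast
    ring
  have hK : 576 * T * (1 - 27 * T) ^ 3 ≠ 0 :=
    mul_ne_zero (mul_ne_zero (by norm_num) hT) (pow_ne_zero 3 (sub_ne_zero.2 hT'.symm))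
  have hC : C ((576 * T * (1 - 27 * T) ^ 3)⁻¹) *
      (576 * C T * (1 - 27 * C T) ^ 3) = 1 := by
    have := congrArg C (inv_mul_cancel₀ hK)
    simpa only [map_mul, map_pow, map_sub, map_one, map_ofNat] using this
  let p : L[X] := -432 * C T - 2
  let q : L[X] := 126 * C T + 972 * C T ^ 2
  refine ⟨C ((576 * T * (1 - 27 * T) ^ 3)⁻¹) * (36 * (-12 * p * X + 2 * p + 12 * q)),
    C ((576 * T * (1 - 27 * T) ^ 3)⁻¹) *
      (p ^ 2 + (-12 * p * X + 2 * p + 12 * q) * (-12 * X + 1)), ?_⟩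
  rw [hd, kernelCubic]
  simp only [p, q]
  linear_combination hC

theorem natDegree_kernelCubic {L : Type*} [Field L] [CharZero L] (T : L) :
    (kernelCubic T).natDegree = 3 := by
  rw [show kernelCubic T = C (-4) * X ^ 3 + C 1 * X ^ 2 + C (18 * T) * X + C (-4 * T - 27 * T ^ 2) by
    simp only [kernelCubic, map_mul, map_sub, map_neg, map_pow, map_ofNat, map_one]
    ring]
  exact natDegree_cubic (by norm_num)

theorem coeffDerivation_eq_zero_of_pell {k L : Type*} [CommRing k] [Field L] [CharZero L]
    [Algebra k L] (D : Derivation k L L) {T : L} (hT : T ≠ 0) (hT' : 27 * T ≠ 1) (hDT : D T = 0)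
    {l S V : L[X]} (hl : l.natDegree = 1) (hDl : D (l.coeff 1) = 0) (hV : V ≠ 0) {m : ℕ}
    (h : V ^ 2 = kernelCubic T * (S ^ 2 - 4 * l ^ m)) (hS : 2 * S.natDegree ≤ m)
    (hVd : 2 * V.natDegree ≤ m + 3) :
    (∀ n, D (S.coeff n) = 0) ∧ ∀ n, D (V.coeff n) = 0 := by
  have hd := squarefree_kernelCubic hT hT'
  have hDd : coeffDerivation D (kernelCubic T) = 0 := by
    have hC : coeffDerivation D (C T) = 0 := by
      ext n
      rw [coeff_coeffDerivation, coeff_C]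
      split_ifs <;> simp [hDT]
    have hX : coeffDerivation D X = 0 := by
      ext n
      rw [coeff_coeffDerivation, coeff_X]
      split_ifs <;> simp
    have hN : ∀ n : ℕ, coeffDerivation D (n : L[X]) = 0 := fun n => Derivation.map_natCast _ n
    have h4 := hN 4
    have h18 := hN 18
    have h27 := hN 27
    push_cast at h4 h18 h27
    simp [kernelCubic, Derivation.leibniz, Derivation.leibniz_pow, hC, hX, h4, h18, h27]
  obtain ⟨r, rfl⟩ := (hd.dvd_pow_iff_dvd two_ne_zero).1 (Dvd.intro _ h.symm)
  have hr := right_ne_zero_of_mul hV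
  rw [natDegree_mul hd.ne_zero hr, natDegree_kernelCubic] at hVd
  have hb : coeffDerivation D l = C (D (l.coeff 0)) := by
    ext n
    rw [coeff_coeffDerivation, coeff_C]
    split_ifs with hn
    · rw [hn]
    · rcases eq_or_ne n 1 with rfl | hn1
      · exact hDl
      · rw [coeff_eq_zero_of_natDegree_lt (by omega), map_zero]
  obtain ⟨-, h1, h2⟩ := pell_derivation_eq_zero (coeffDerivation D) (natDegree_coeffDerivation_le D)
    hd hDd hl hb m S r hr (by
      apply mul_left_cancel₀ hd.ne_zero
      linear_combination -h) hS (by omega)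
  refine ⟨fun n => ?_, fun n => ?_⟩
  · rw [← coeff_coeffDerivation, h1, coeff_zero]
  · rw [← coeff_coeffDerivation, Derivation.leibniz, h2, hDd]
    simp
end

section
open scoped PowerSeries
variable {R : Type*} [CommRing R] [IsDomain R] {F : Type*} [Field F] [Algebra R⟦X⟧ F]
  [FaithfulSMul R⟦X⟧ F] {c : R⟦X⟧}

theorem algebraMap_X_ne_zero : algebraMap R⟦X⟧ F PowerSeries.X ≠ 0 :=
  (map_ne_zero_iff _ (FaithfulSMul.algebraMap_injective _ _)).2 PowerSeries.X_ne_zero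

theorem algebraMap_sum_eq_eval₂ {M : ℕ} {P : Polynomial R} (hP : 2 * P.natDegree ≤ M) :
    algebraMap R⟦X⟧ F (∑ j ∈ Finset.range (P.natDegree + 1),
      PowerSeries.C (P.coeff j) * c ^ j * PowerSeries.X ^ (M - 2 * j)) =
    algebraMap R⟦X⟧ F PowerSeries.X ^ M * P.eval₂ ((algebraMap R⟦X⟧ F).comp PowerSeries.C)
      (algebraMap R⟦X⟧ F c / algebraMap R⟦X⟧ F PowerSeries.X ^ 2) := by
  rw [Polynomial.eval₂_eq_sum_range, Finset.mul_sum, map_sum]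
  refine Finset.sum_congr rfl fun j hj => ?_
  have hj' : 2 * j ≤ M := by
    have := Finset.mem_range_succ_iff.1 hj
    omega
  have hX := algebraMap_X_ne_zero (R := R) (F := F)
  rw [map_mul, map_mul, map_pow, map_pow, RingHom.comp_apply, div_pow, ← pow_mul]
  nth_rewrite 2 [← Nat.sub_add_cancel hj']
  rw [pow_add]
  field_simp

theorem IsHomogeneousIn.eq_sum {M : ℕ} {f : R⟦X⟧} {P : Polynomial R}
    (h : IsHomogeneousIn F c M f P) :
    f = ∑ j ∈ Finset.range (P.natDegree + 1),
      PowerSeries.C (P.coeff j) * c ^ j * PowerSeries.X ^ (M - 2 * j) :=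
  FaithfulSMul.algebraMap_injective R⟦X⟧ F (h.2.trans (algebraMap_sum_eq_eval₂ h.1).symm)

variable (F) in
theorem eval₂_div_sq_injective (hc : PowerSeries.constantCoeff c = -1) {P : Polynomial R}
    (h : P.eval₂ ((algebraMap R⟦X⟧ F).comp PowerSeries.C)
      (algebraMap R⟦X⟧ F c / algebraMap R⟦X⟧ F PowerSeries.X ^ 2) = 0) : P = 0 := by
  have h1 := algebraMap_sum_eq_eval₂ (F := F) (c := c) (le_refl (2 * P.natDegree))
  rw [h, mul_zero, map_eq_zero_iff _ (FaithfulSMul.algebraMap_injective _ _)] at h1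
  have h2 := congrArg PowerSeries.constantCoeff h1
  rw [map_sum, Finset.sum_eq_single P.natDegree, map_zero] at h2
  · simpa [hc] using h2
  · intro j hj hne
    have := Finset.mem_range_succ_iff.1 hj
    rw [map_mul, map_pow, PowerSeries.constantCoeff_X, zero_pow (by omega), mul_zero]
  · simp

/-- The constant coefficient of a form of degree `2` in `X` and `√c`. -/
theorem IsHomogeneousIn.coeff_one (hc : PowerSeries.constantCoeff c = -1) {f : R⟦X⟧}
    {P : Polynomial R} (h : IsHomogeneousIn F c 2 f P) :
    P.coeff 1 = -PowerSeries.constantCoeff f := by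
  rw [h.eq_sum]
  have hd : P.natDegree = 0 ∨ P.natDegree = 1 := by
    have := h.1
    omega
  rcases hd with hd | hd
  · rw [hd, Polynomial.coeff_eq_zero_of_natDegree_lt (by omega)]
    simp
  · rw [hd]
    simp [Finset.sum_range_succ, hc]

theorem eq_kernelCubic_mul_of_isHomogeneousIn (hc : PowerSeries.constantCoeff c = -1) {t : R}
    {n : ℕ} {q f g : R⟦X⟧} {l S V : Polynomial R} (hq : IsHomogeneousIn F c 2 q l)
    (hf : IsHomogeneousIn F c n f S) (hg : IsHomogeneousIn F c (n + 3) g V)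
    (h : g ^ 2 = (-4 * c ^ 3 + PowerSeries.X ^ 2 * c ^ 2 +
      18 * PowerSeries.C t ^ 3 * PowerSeries.X ^ 4 * c - 4 * PowerSeries.C t ^ 3 * PowerSeries.X ^ 6 -
      27 * PowerSeries.C t ^ 6 * PowerSeries.X ^ 6) * (f ^ 2 - 4 * q ^ n)) :
    V ^ 2 = kernelCubic (t ^ 3) * (S ^ 2 - 4 * l ^ n) := by
  have hX := algebraMap_X_ne_zero (R := R) (F := F)
  rw [← sub_eq_zero]
  apply eval₂_div_sq_injective F hc
  have h1 := congrArg (algebraMap R⟦X⟧ F) h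
  simp only [map_mul, map_add, map_sub, map_pow, map_neg, map_ofNat, hq.2, hf.2, hg.2] at h1
  have hcF : algebraMap R⟦X⟧ F c = algebraMap R⟦X⟧ F PowerSeries.X ^ 2 *
      (algebraMap R⟦X⟧ F c / algebraMap R⟦X⟧ F PowerSeries.X ^ 2) := by
    field_simp
  simp only [kernelCubic, Polynomial.eval₂_sub, Polynomial.eval₂_mul, Polynomial.eval₂_add,
    Polynomial.eval₂_pow, Polynomial.eval₂_C, Polynomial.eval₂_X, Polynomial.eval₂_neg,
    Polynomial.eval₂_ofNat, RingHom.comp_apply, map_pow]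
  set i := algebraMap R⟦X⟧ F c / algebraMap R⟦X⟧ F PowerSeries.X ^ 2
  rw [hcF] at h1
  apply mul_left_cancel₀ (pow_ne_zero (2 * n + 6) hX)
  linear_combination h1
end

noncomputable section
open scoped PowerSeries

/-- The derivation of `L⟦X⟧` acting on coefficients. -/
def seriesDerivation {k L : Type*} [CommRing k] [CommRing L] [Algebra k L] (D : Derivation k L L) :
    Derivation k L⟦X⟧ L⟦X⟧ :=
  Derivation.mk'
    { toFun := fun f => PowerSeries.mk fun n => D (PowerSeries.coeff n f)
      map_add' := fun f g => by ext; simp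
      map_smul' := fun c f => by ext; simp } fun f g => by
    ext n
    simp only [LinearMap.coe_mk, AddHom.coe_mk, PowerSeries.coeff_mk, PowerSeries.coeff_mul,
      map_sum, Derivation.leibniz, smul_eq_mul, map_add, Finset.sum_add_distrib]
    rw [← Finset.Nat.sum_antidiagonal_swap (f := fun p =>
      PowerSeries.coeff p.1 g * D (PowerSeries.coeff p.2 f))]
    rfl

section
variable {k L : Type*} [CommRing k] [CommRing L] [Algebra k L] (D : Derivation k L L)

theorem coeff_seriesDerivation (f : L⟦X⟧) (n : ℕ) :
    PowerSeries.coeff n (seriesDerivation D f) = D (PowerSeries.coeff n f) := by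
  simp [seriesDerivation]

theorem seriesDerivation_C (r : L) :
    seriesDerivation D (PowerSeries.C r) = PowerSeries.C (D r) := by
  ext n
  rw [coeff_seriesDerivation, PowerSeries.coeff_C, PowerSeries.coeff_C]
  split_ifs <;> simp

theorem seriesDerivation_X : seriesDerivation D PowerSeries.X = 0 := by
  ext n
  rw [coeff_seriesDerivation, PowerSeries.coeff_X]
  split_ifs <;> simp
end

theorem Derivation.eq_zero_of_pow {k A : Type*} [CommRing k] [CommRing A] [IsDomain A] [CharZero A]
    [Algebra k A] (D : Derivation k A A) {a : A} {n : ℕ} (ha : a ≠ 0) (hn : n ≠ 0)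
    (h : D (a ^ n) = 0) : D a = 0 := by
  rw [D.leibniz_pow, smul_eq_mul, nsmul_eq_mul, mul_eq_zero, Nat.cast_eq_zero, mul_eq_zero] at h
  exact (h.resolve_left hn).resolve_left (pow_ne_zero _ ha)

theorem IsHomogeneousIn.seriesDerivation_map_eq_zero {R F k L : Type*} [CommRing R] [IsDomain R]
    [Field F] [Algebra R⟦X⟧ F] [FaithfulSMul R⟦X⟧ F] [CommRing k] [CommRing L] [Algebra k L]
    (D : Derivation k L L) (φ : R →+* L) {c f : R⟦X⟧} {M : ℕ} {P : Polynomial R}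
    (h : IsHomogeneousIn F c M f P) (hc : seriesDerivation D (PowerSeries.map φ c) = 0)
    (hP : ∀ n, D (φ (P.coeff n)) = 0) : seriesDerivation D (PowerSeries.map φ f) = 0 := by
  rw [h.eq_sum, map_sum, map_sum]
  refine Finset.sum_eq_zero fun j _ => ?_
  simp [Derivation.leibniz, Derivation.leibniz_pow, seriesDerivation_C, seriesDerivation_X, hP, hc]

variable {R : Type*} [CommRing R] [IsDomain R] {t : R} {ι : R⟦X⟧ →ₐ[R] R⟦X⟧} {w : R⟦X⟧}

theorem exists_isHomogeneousIn_of_map_eq {k : Type*} [Field k] [CharZero k] {ε : R →+* k}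
    (ht : t ≠ 0) (hεt : ε t = 0) (hε : ∀ r, ε r = 0 → t ∣ r)
    (hsep : ∀ r : R, (∀ N, t ^ N ∣ r) → r = 0) (F : Type*) [Field F] [Algebra R⟦X⟧ F]
    [FaithfulSMul R⟦X⟧ F] (hw : w * ι w = 1)
    (hιw : ι w = 1 - PowerSeries.X - (PowerSeries.C t * PowerSeries.X) ^ 3 * w)
    (hιX : ι PowerSeries.X = -PowerSeries.X * w) {M : ℕ} {f : R⟦X⟧} (hf : f ∈ polySubalgebra t)
    (hιf : ι f = (-1) ^ M * w ^ M * f) :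
    ∃ P, IsHomogeneousIn F (PowerSeries.X - 1 + (PowerSeries.C t * PowerSeries.X) ^ 3) M f P := by
  have hX := X_mem_polySubalgebra t
  have hC := C_mem_polySubalgebra t t
  have hιC : ι (PowerSeries.C t) = PowerSeries.C t := ι.commutes t
  refine exists_isHomogeneousIn ht hεt hε hsep F two_ne_zero ι ?_
    (add_mem (sub_mem hX (one_mem _)) (pow_mem (mul_mem hC hX) 3)) ?_ ?_ hf ?_
  · have h1 := hw
    rw [hιw] at h1
    have h2 := congrArg (PowerSeries.map ε) h1
    simp only [map_mul, map_sub, map_pow, map_one, PowerSeries.map_X, PowerSeries.map_C, hεt,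
      map_zero] at h2
    rw [hιX]
    simp only [map_mul, map_neg, PowerSeries.map_X]
    linear_combination (-PowerSeries.X) * h2
  · simp only [map_add, map_sub, map_mul, map_pow, map_one, hιX, hιC]
    rw [hιw] at hw
    linear_combination (-(1 + w)) * PowerSeries.X ^ 2 * hw
  · simp
  · rw [hιX, hιf]
    ring
end

noncomputable section
open scoped PowerSeries

variable {R : Type*} [CommRing R]

/-- The first of the two sections of the boundary series which the kernel involution swaps. -/
def kernelFst (t s : R) (w A B : R⟦X⟧) : R⟦X⟧ :=
  -(PowerSeries.C t * PowerSeries.X * w) *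
      (PowerSeries.C ((1 - s ^ 3) * s * t ^ 2) * PowerSeries.X * B - PowerSeries.C (s ^ 2) -
        PowerSeries.C (s ^ 3 * t) * PowerSeries.X) -
    (PowerSeries.C ((1 - s ^ 3) * t ^ 2) * PowerSeries.X * A + PowerSeries.C s)

/-- The second of the two sections of the boundary series which the kernel involution swaps. -/
def kernelSnd (t s : R) (w A B : R⟦X⟧) : R⟦X⟧ :=
  (PowerSeries.C ((1 - s ^ 3) * s * t ^ 2) * PowerSeries.X * B - PowerSeries.C (s ^ 2) -
      PowerSeries.C (s ^ 3 * t) * PowerSeries.X) +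
    (PowerSeries.C t * PowerSeries.X) ^ 2 * w *
      (PowerSeries.C ((1 - s ^ 3) * t ^ 2) * PowerSeries.X * A + PowerSeries.C s)

variable {t s s' : R} {ι : R⟦X⟧ →ₐ[R] R⟦X⟧} {w A B : R⟦X⟧}

theorem map_kernelSnd (hs : s * s' = 1) (hw : w * ι w = 1)
    (hιX : ι PowerSeries.X = -PowerSeries.X * w)
    (hAB : PowerSeries.X * ι PowerSeries.X = PowerSeries.X * A + ι PowerSeries.X * ι B -
      PowerSeries.C s * PowerSeries.C t * PowerSeries.X * ι PowerSeries.X * B -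
      PowerSeries.C s' * PowerSeries.C t ^ 2 * PowerSeries.X * ι PowerSeries.X ^ 2 * ι A) :
    ι (kernelSnd t s w A B) = PowerSeries.C s * kernelFst t s w A B := by
  have hιC : ∀ r, ι (PowerSeries.C r) = PowerSeries.C r := ι.commutes
  have hs' : PowerSeries.C s * PowerSeries.C s' = (1 : R⟦X⟧) := by rw [← map_mul, hs, map_one]
  rw [hιX] at hAB
  simp only [kernelSnd, kernelFst, map_add, map_sub, map_mul, map_pow, map_one, hιC, hιX]
  generalize PowerSeries.C s = σ at *
  generalize PowerSeries.C s' = τ at *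
  generalize PowerSeries.C t = t at *
  generalize (PowerSeries.X : R⟦X⟧) = u at *
  generalize ι w = wi at *
  generalize ι A = A' at *
  generalize ι B = B' at *
  linear_combination (-(1 - σ ^ 3) * σ * t ^ 2) * hAB +
    ((1 - σ ^ 3) * t ^ 4 * u ^ 3 * w ^ 2 * A') * hs' +
    (t ^ 2 * u ^ 2 * w * (-(1 - σ ^ 3) * t ^ 2 * u * w * A' + σ)) * hw

theorem map_map_apply (hw : w * ι w = 1) (hιX : ι PowerSeries.X = -PowerSeries.X * w) (f : R⟦X⟧) :
    ι (ι f) = f := by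
  refine PowerSeries.algHom_apply_eq_self (ι.comp ι) ?_ f
  rw [AlgHom.comp_apply, hιX, map_mul, map_neg, hιX]
  linear_combination PowerSeries.X * hw

variable [IsDomain R]

theorem exists_pell_of_kernel_equation {k : Type*} [Field k] [CharZero k] {ε : R →+* k}
    (ht : t ≠ 0) (hεt : ε t = 0) (hε : ∀ r, ε r = 0 → t ∣ r)
    (hsep : ∀ r : R, (∀ N, t ^ N ∣ r) → r = 0) (F : Type*) [Field F] [Algebra R⟦X⟧ F]
    [FaithfulSMul R⟦X⟧ F] (hs : s * s' = 1) (hw : w * ι w = 1)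
    (hιw : ι w = 1 - PowerSeries.X - (PowerSeries.C t * PowerSeries.X) ^ 3 * w)
    (hιX : ι PowerSeries.X = -PowerSeries.X * w)
    (hA : A ∈ polySubalgebra t) (hB : B ∈ polySubalgebra t)
    (hAB : PowerSeries.X * ι PowerSeries.X = PowerSeries.X * A + ι PowerSeries.X * ι B -
      PowerSeries.C s * PowerSeries.C t * PowerSeries.X * ι PowerSeries.X * B -
      PowerSeries.C s' * PowerSeries.C t ^ 2 * PowerSeries.X * ι PowerSeries.X ^ 2 * ι A)
    {n : ℕ} (hn : Even n) (hsn : s ^ (3 * n) = 1) {a b q J c : R⟦X⟧}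
    (ha : a = kernelFst t s w A B ^ 3 * ι w ^ 2) (hb : b = -(kernelSnd t s w A B ^ 3 * ι w))
    (hq : q = kernelFst t s w A B * kernelSnd t s w A B * ι w)
    (hJ : J = kernelRoot (PowerSeries.C t * PowerSeries.X) w (ι w))
    (hc : c = PowerSeries.X - 1 + (PowerSeries.C t * PowerSeries.X) ^ 3) :
    ∃ l S V : Polynomial R, IsHomogeneousIn F c 2 q l ∧
      IsHomogeneousIn F c (3 * n) (a ^ n + b ^ n) S ∧
      IsHomogeneousIn F c (3 * n + 3) (J * (a ^ n - b ^ n)) V ∧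
      V ^ 2 = kernelCubic (t ^ 3) * (S ^ 2 - 4 * l ^ (3 * n)) := by
  have hιC : ∀ r, ι (PowerSeries.C r) = PowerSeries.C r := ι.commutes
  have hιι := map_map_apply hw hιX
  have hs' : PowerSeries.C s * PowerSeries.C s' = (1 : R⟦X⟧) := by rw [← map_mul, hs, map_one]
  have hu : (PowerSeries.X : R⟦X⟧) = 1 - ι w - (PowerSeries.C t * PowerSeries.X) ^ 3 * w := by
    linear_combination hιw
  have hX := X_mem_polySubalgebra t
  have hC := C_mem_polySubalgebra t
  have hz : PowerSeries.C t * PowerSeries.X ∈ polySubalgebra t := mul_mem (hC t) hX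
  have h1 := map_kernelSnd hs hw hιX hAB
  have h2 : ι (kernelFst t s w A B) = PowerSeries.C s' * kernelSnd t s w A B := by
    have := congrArg ι h1
    rw [hιι, map_mul, hιC] at this
    linear_combination (-ι (kernelFst t s w A B)) * hs' - PowerSeries.C s' * this
  have hS1 : a * b ∈ polySubalgebra t ∧ a + b ∈ polySubalgebra t ∧ q ∈ polySubalgebra t ∧
      J * (a - b) ∈ polySubalgebra t := by
    obtain ⟨p, hp, hp'⟩ : ∃ p ∈ polySubalgebra t, p = PowerSeries.C ((1 - s ^ 3) * s * t ^ 2) *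
        PowerSeries.X * B - PowerSeries.C (s ^ 2) - PowerSeries.C (s ^ 3 * t) * PowerSeries.X :=
      ⟨_, sub_mem (sub_mem (mul_mem (mul_mem (hC _) hX) hB) (hC _)) (mul_mem (hC _) hX), rfl⟩
    obtain ⟨g, hg, hg'⟩ : ∃ g ∈ polySubalgebra t, g = PowerSeries.C ((1 - s ^ 3) * t ^ 2) *
        PowerSeries.X * A + PowerSeries.C s :=
      ⟨_, add_mem (mul_mem (mul_mem (hC _) hX) hA) (hC _), rfl⟩
    rw [kernelFst, kernelSnd, ← hp', ← hg'] at hq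
    rw [kernelFst, ← hp', ← hg'] at ha
    rw [kernelSnd, ← hp', ← hg'] at hb
    have hN : ∀ m : ℕ, (m : R⟦X⟧) ∈ polySubalgebra t := fun m => natCast_mem _ m
    have hN2 : (2 : R⟦X⟧) ∈ polySubalgebra t := mod_cast hN 2
    have hN3 : (3 : R⟦X⟧) ∈ polySubalgebra t := mod_cast hN 3
    have hN4 : (4 : R⟦X⟧) ∈ polySubalgebra t := mod_cast hN 4
    have hN6 : (6 : R⟦X⟧) ∈ polySubalgebra t := mod_cast hN 6
    have hX1 := sub_mem (one_mem (polySubalgebra t)) hX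
    have hqS : q ∈ polySubalgebra t := by
      rw [hq, kernel_mul_eq _ _ _ _ _ _ hw hu]
      exact neg_mem (add_mem (add_mem (mul_mem hz (pow_mem hp 2)) (mul_mem (mul_mem hX1 hp) hg))
        (mul_mem (pow_mem hz 2) (pow_mem hg 2)))
    refine ⟨?_, ?_, hqS, ?_⟩
    · rw [show a * b = -q ^ 3 by rw [ha, hb, hq]; ring]
      exact neg_mem (pow_mem hqS 3)
    · rw [ha, hb, kernel_cube_add_cube_eq _ _ _ _ _ _ hw hu]
      exact add_mem (sub_mem (sub_mem (mul_mem (neg_mem hX1) (pow_mem hp 3))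
        (mul_mem (mul_mem (mul_mem hN6 (pow_mem hz 2)) (pow_mem hp 2)) hg))
        (mul_mem (mul_mem (mul_mem (mul_mem hN3 hz) hX1) hp) (pow_mem hg 2)))
        (mul_mem (sub_mem (mul_mem hN2 (pow_mem hz 3)) (pow_mem hX1 2)) (pow_mem hg 3))
    · rw [ha, hb, kernel_cube_sub_cube_eq _ _ _ _ _ _ hw hu, ← mul_assoc, hJ,
        kernelRoot_mul_eq _ _ _ _ hw hu]
      exact mul_mem (mul_mem (neg_mem (add_mem (sub_mem hN2 hX) (pow_mem hz 3)))
        (sub_mem (pow_mem hX1 2) (mul_mem hN4 (pow_mem hz 3))))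
        (sub_mem (sub_mem (pow_mem hp 3) (mul_mem (mul_mem (mul_mem hN3 hz) hp) (pow_mem hg 2)))
          (mul_mem hX1 (pow_mem hg 3)))
  obtain ⟨hab, hab', hqS, hJab⟩ := hS1
  have hιa : ι a = -PowerSeries.C s' ^ 3 * (b * w ^ 3) := by
    rw [ha, hb, map_mul, map_pow, map_pow, h2, hιι]
    linear_combination (-PowerSeries.C s' ^ 3 * kernelSnd t s w A B ^ 3 * w ^ 2) * hw
  have hιb : ι b = -PowerSeries.C s ^ 3 * (a * w ^ 3) := by
    rw [ha, hb, map_neg, map_mul, map_pow, h1, hιι]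
    linear_combination (PowerSeries.C s ^ 3 * kernelFst t s w A B ^ 3 * w * (w * ι w + 1)) * hw
  have hsn1 : (PowerSeries.C s ^ 3) ^ n = (1 : R⟦X⟧) := by
    rw [← pow_mul, ← map_pow, hsn, map_one]
  have hsn2 : (PowerSeries.C s' ^ 3) ^ n = (1 : R⟦X⟧) := by
    rw [← one_mul ((PowerSeries.C s' ^ 3) ^ n)]
    nth_rewrite 1 [← hsn1]
    rw [← mul_pow, ← mul_pow, hs', one_pow, one_pow]
  have hιan : ι (a ^ n) = w ^ (3 * n) * b ^ n := by
    rw [map_pow, hιa, mul_pow, hn.neg_pow, hsn2, mul_pow, pow_mul]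
    ring
  have hιbn : ι (b ^ n) = w ^ (3 * n) * a ^ n := by
    rw [map_pow, hιb, mul_pow, hn.neg_pow, hsn1, mul_pow, pow_mul]
    ring
  have hιJ : ι J = w ^ 3 * J := by
    rw [hJ, kernelRoot]
    simp only [map_mul, map_add, map_sub, map_pow, map_one, hιι, hιX, hιC]
    have e1 : (1 + ι w) * w = 1 + w := by linear_combination hw
    have e2 : (PowerSeries.C t * (-PowerSeries.X * w)) ^ 3 * ι w ^ 2 =
        -((PowerSeries.C t * PowerSeries.X) ^ 3 * w) := by
      linear_combination (-(PowerSeries.C t * PowerSeries.X) ^ 3 * w * (w * ι w + 1)) * hw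
    have e3 : (PowerSeries.C t * (-PowerSeries.X * w)) ^ 3 * ι w =
        -((PowerSeries.C t * PowerSeries.X) ^ 3 * w ^ 2) := by
      linear_combination (-(PowerSeries.C t * PowerSeries.X) ^ 3 * w ^ 2) * hw
    have e4 : w ^ 3 * ι w ^ 2 = w := by linear_combination (w * (w * ι w + 1)) * hw
    rw [e2, e3]
    generalize (PowerSeries.C t * PowerSeries.X) ^ 3 = r
    linear_combination (w * (1 + r * w) * (r * w ^ 2 - 1)) * e1 -
      ((1 + w) * (r * w ^ 2 - 1) * (1 + r * w)) * e4
  obtain ⟨l, hl⟩ := exists_isHomogeneousIn_of_map_eq ht hεt hε hsep F hw hιw hιX (M := 2) hqS (by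
    rw [hq, map_mul, map_mul, h1, h2, hιι]
    linear_combination (kernelFst t s w A B * kernelSnd t s w A B * w) * (hs' - hw))
  have h3n : Even (3 * n) := hn.mul_left 3
  have hSn := (polySubalgebra t).mul_pow_add_mul_pow_mem hab' hab (x := 1) (y := 1)
    (add_mem (one_mem _) (one_mem _)) (by simpa using hab') n
  have hVn := (polySubalgebra t).mul_pow_add_mul_pow_mem hab' hab (x := J) (y := -J)
    (by simp) (by convert hJab using 1; ring) n
  obtain ⟨S, hS⟩ := exists_isHomogeneousIn_of_map_eq ht hεt hε hsep F hw hιw hιX (M := 3 * n)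
    (f := a ^ n + b ^ n) (by simpa using hSn) (by
    rw [map_add, hιan, hιbn, h3n.neg_one_pow]
    ring)
  obtain ⟨V, hV⟩ := exists_isHomogeneousIn_of_map_eq ht hεt hε hsep F hw hιw hιX (M := 3 * n + 3)
    (f := J * (a ^ n - b ^ n)) (by convert hVn using 1; ring) (by
    rw [map_mul, map_sub, hιan, hιbn, hιJ, pow_add, h3n.neg_one_pow]
    ring)
  rw [← hc] at hl hS hV
  refine ⟨l, S, V, hl, hS, hV, eq_kernelCubic_mul_of_isHomogeneousIn (by simp [hc]) hl hS hV ?_⟩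
  have habn : a ^ n * b ^ n = q ^ (3 * n) := by
    rw [← mul_pow, show a * b = -q ^ 3 by rw [ha, hb, hq]; ring, hn.neg_pow, pow_mul]
  have hJ2 := kernelRoot_sq_eq _ _ _ (PowerSeries.C t) hw hu
  rw [← hJ, ← hc] at hJ2
  rw [mul_pow, hJ2, ← habn]
  ring
end

section
open scoped PowerSeries

variable {R : Type*} [CommRing R] {t s s' : R} {ι : R⟦X⟧ →ₐ[R] R⟦X⟧} {w A B : R⟦X⟧}

theorem PowerSeries.constantCoeff_map_apply {S : Type*} [CommRing S] (φ : R →+* S) (f : R⟦X⟧) :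
    PowerSeries.constantCoeff (PowerSeries.map φ f) = φ (PowerSeries.constantCoeff f) := by
  rw [← PowerSeries.coeff_zero_eq_constantCoeff_apply, PowerSeries.coeff_map,
    PowerSeries.coeff_zero_eq_constantCoeff_apply]

theorem constantCoeff_kernelFst : PowerSeries.constantCoeff (kernelFst t s w A B) = -s := by
  simp [kernelFst]

theorem constantCoeff_kernelSnd : PowerSeries.constantCoeff (kernelSnd t s w A B) = -s ^ 2 := by
  simp [kernelSnd]

theorem coeff_one_kernelFst (hw0 : PowerSeries.constantCoeff w = 1) :
    PowerSeries.coeff 1 (kernelFst t s w A B) =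
      t * s ^ 2 - (1 - s ^ 3) * t ^ 2 * PowerSeries.constantCoeff A := by
  have h : kernelFst t s w A B = PowerSeries.X *
      (-(PowerSeries.C t * w * (PowerSeries.C ((1 - s ^ 3) * s * t ^ 2) * PowerSeries.X * B -
        PowerSeries.C (s ^ 2) - PowerSeries.C (s ^ 3 * t) * PowerSeries.X)) -
        PowerSeries.C ((1 - s ^ 3) * t ^ 2) * A) - PowerSeries.C s := by
    rw [kernelFst]
    ring
  rw [h, map_sub, ← zero_add 1, PowerSeries.coeff_succ_X_mul,
    PowerSeries.coeff_zero_eq_constantCoeff]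
  simp [hw0]

theorem kernel_power_sub_power_ne_zero {k : Type*} [Field k] [CharZero k] {ε : R →+* k}
    (hεt : ε t = 0)
    (hιw : ι w = 1 - PowerSeries.X - (PowerSeries.C t * PowerSeries.X) ^ 3 * w)
    (hw0 : PowerSeries.constantCoeff w = 1) {n : ℕ} (hn0 : n ≠ 0) (hn : Even n)
    (hsn : s ^ (3 * n) = 1) :
    kernelRoot (PowerSeries.C t * PowerSeries.X) w (ι w) *
      ((kernelFst t s w A B ^ 3 * ι w ^ 2) ^ n - (-(kernelSnd t s w A B ^ 3 * ι w)) ^ n) ≠ 0 := by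
  have hwi0 : PowerSeries.constantCoeff (ι w) = 1 := by simp [hιw]
  intro h
  have h1 := congrArg (PowerSeries.map ε) h
  rw [map_zero, map_mul, mul_eq_zero] at h1
  rcases h1 with h1 | h1
  · have := congrArg PowerSeries.constantCoeff h1
    rw [map_zero, PowerSeries.constantCoeff_map_apply] at this
    simp [kernelRoot, hw0, hwi0] at this
  · have e1 : PowerSeries.map ε (ι w) = 1 - PowerSeries.X := by
      rw [hιw]
      simp [hεt]
    have e2 : PowerSeries.map ε (kernelFst t s w A B) = -PowerSeries.C (ε s) := by
      simp [kernelFst, hεt]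
    have e3 : PowerSeries.map ε (kernelSnd t s w A B) = -PowerSeries.C (ε s) ^ 2 := by
      simp [kernelSnd, hεt]
    have hσ : (PowerSeries.C (ε s)) ^ (3 * n) = (1 : k⟦X⟧) := by
      rw [← map_pow, ← map_pow, hsn, map_one, map_one]
    rw [map_sub, map_pow, map_pow, map_neg, map_mul, map_mul, map_pow, map_pow, map_pow, e1, e2, e3]
      at h1
    have h2 : (1 - PowerSeries.X : k⟦X⟧) ^ n * ((1 - PowerSeries.X) ^ n - 1) = 0 := by
      rw [← h1, hn.neg_pow, mul_pow, mul_pow, ← pow_mul, ← pow_mul, ← pow_mul,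
        (hn.mul_left 3).neg_pow, (hn.mul_left 3).neg_pow, hσ, ← pow_mul,
        mul_comm 2 (3 * n), pow_mul _ (3 * n) 2, hσ]
      ring
    rcases mul_eq_zero.1 h2 with h3 | h3
    · have := congrArg PowerSeries.constantCoeff h3
      simp at this
    · have h4 : ((1 - Polynomial.X : Polynomial k) ^ n - 1 : Polynomial k) = 0 := by
        apply Polynomial.coe_injective k
        push_cast
        exact h3
      have := congrArg (Polynomial.eval 1) h4
      simp [hn0] at this

variable [IsDomain R]

theorem derivation_constantCoeff_eq_zero {k : Type*} [Field k] [CharZero k] {ε : R →+* k}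
    (ht : t ≠ 0) (hεt : ε t = 0) (hε : ∀ r, ε r = 0 → t ∣ r)
    (hsep : ∀ r : R, (∀ N, t ^ N ∣ r) → r = 0) (hs : s * s' = 1) (hw : w * ι w = 1)
    (hιw : ι w = 1 - PowerSeries.X - (PowerSeries.C t * PowerSeries.X) ^ 3 * w)
    (hιX : ι PowerSeries.X = -PowerSeries.X * w) (hw0 : PowerSeries.constantCoeff w = 1)
    (hA : A ∈ polySubalgebra t) (hB : B ∈ polySubalgebra t)
    (hAB : PowerSeries.X * ι PowerSeries.X = PowerSeries.X * A + ι PowerSeries.X * ι B -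
      PowerSeries.C s * PowerSeries.C t * PowerSeries.X * ι PowerSeries.X * B -
      PowerSeries.C s' * PowerSeries.C t ^ 2 * PowerSeries.X * ι PowerSeries.X ^ 2 * ι A)
    {n : ℕ} (hn0 : n ≠ 0) (hn : Even n) (hsn : s ^ (3 * n) = 1) (hs3 : s ^ 3 ≠ 1)
    {k₀ L : Type*} [CommRing k₀] [Field L] [CharZero L] [Algebra k₀ L] (φ : R →+* L)
    (hφ : Function.Injective φ) (D : Derivation k₀ L L) (hDt : D (φ t) = 0) (hDs : D (φ s) = 0) :
    D (φ (PowerSeries.constantCoeff A)) = 0 := by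
  let F := FractionRing R⟦X⟧
  have hs0 : s ≠ 0 := left_ne_zero_of_mul (hs.trans_ne one_ne_zero)
  have hwi0 : PowerSeries.constantCoeff (ι w) = 1 := by simp [hιw]
  obtain ⟨l, S, V, hl, hS, hV, hSV⟩ := exists_pell_of_kernel_equation ht hεt hε hsep F hs hw hιw
    hιX hA hB hAB hn hsn rfl rfl rfl rfl rfl
  have hV0 : V ≠ 0 := by
    rintro rfl
    have := hV.eq_sum
    rw [Polynomial.natDegree_zero, zero_add, Finset.sum_range_one, Polynomial.coeff_zero, map_zero,
      zero_mul, zero_mul] at this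
    exact kernel_power_sub_power_ne_zero hεt hιw hw0 hn0 hn hsn this
  have hl1 : l.coeff 1 = -s ^ 3 := by
    rw [hl.coeff_one (by simp), map_mul, map_mul, constantCoeff_kernelFst, constantCoeff_kernelSnd,
      hwi0]
    ring
  have hT' : 27 * φ t ^ 3 ≠ 1 := by
    intro h
    have h1 : 27 * t ^ 3 = 1 := hφ (by rw [map_mul, map_pow, map_ofNat, map_one, h])
    simpa [hεt] using congrArg ε h1
  have hldeg : l.natDegree = 1 := by
    refine le_antisymm (by have := hl.1; omega) (Polynomial.le_natDegree_of_ne_zero ?_)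
    rw [hl1]
    exact neg_ne_zero.2 (pow_ne_zero 3 hs0)
  have hkc : (kernelCubic (t ^ 3)).map φ = kernelCubic (φ t ^ 3) := by
    simp [kernelCubic]
  obtain ⟨hDS, hDV⟩ := coeffDerivation_eq_zero_of_pell D (T := φ t ^ 3) (l := l.map φ)
    (S := S.map φ) (V := V.map φ) (m := 3 * n)
    (pow_ne_zero 3 ((map_ne_zero_iff φ hφ).2 ht)) hT' (by simp [D.leibniz_pow, hDt])
    (by rw [Polynomial.natDegree_map_eq_of_injective hφ, hldeg])
    (by simp [hl1, D.leibniz_pow, hDs])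
    ((Polynomial.map_ne_zero_iff hφ).2 hV0)
    (by
      rw [← hkc, ← Polynomial.map_pow, hSV]
      simp)
    (by rw [Polynomial.natDegree_map_eq_of_injective hφ]; exact hS.1)
    (by rw [Polynomial.natDegree_map_eq_of_injective hφ]; exact hV.1)
  simp only [Polynomial.coeff_map] at hDS hDV
  have : CharZero L⟦X⟧ := charZero_of_injective_ringHom PowerSeries.C_injective
  let Δ := seriesDerivation D
  let Φ := PowerSeries.map φ
  have hΦ : Function.Injective Φ := PowerSeries.map_injective φ hφ
  have hΔX : Δ (Φ PowerSeries.X) = 0 := by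
    simp only [Δ, Φ, PowerSeries.map_X, seriesDerivation_X]
  have hΔt : Δ (Φ (PowerSeries.C t)) = 0 := by
    simp only [Δ, Φ, PowerSeries.map_C, seriesDerivation_C, hDt, map_zero]
  have hΔz : Δ ((Φ (PowerSeries.C t) * Φ PowerSeries.X) ^ 3) = 0 := by
    simp [Δ.leibniz_pow, Δ.leibniz, hΔX, hΔt]
  have hWW : Φ w * Φ (ι w) = 1 := by rw [← map_mul, hw, map_one]
  have hΔwi : Δ (Φ (ι w)) = -((Φ (PowerSeries.C t) * Φ PowerSeries.X) ^ 3 * Δ (Φ w)) := by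
    have := congrArg (fun f => Δ (Φ f)) hιw
    simp only [map_sub, map_mul, map_pow, map_one] at this
    rw [this, Δ.leibniz, hΔz, hΔX, Δ.map_one_eq_zero]
    simp
  have hΔw : Δ (Φ w) = 0 := by
    have h1 := congrArg Δ hWW
    rw [Δ.leibniz, hΔwi, Δ.map_one_eq_zero, smul_eq_mul, smul_eq_mul] at h1
    have h2 : Δ (Φ w) * (Φ (ι w) - Φ w * (Φ (PowerSeries.C t) * Φ PowerSeries.X) ^ 3) = 0 := by
      linear_combination h1
    refine (mul_eq_zero.1 h2).resolve_right fun h3 => ?_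
    have := congrArg PowerSeries.constantCoeff h3
    simp [Φ, PowerSeries.constantCoeff_map_apply, hwi0] at this
  rw [hΔw, mul_zero, neg_zero] at hΔwi
  have hΔc : Δ (Φ (PowerSeries.X - 1 + (PowerSeries.C t * PowerSeries.X) ^ 3)) = 0 := by
    simp only [map_add, map_sub, map_one, map_pow, map_mul, hΔz, hΔX, Δ.map_one_eq_zero]
    simp
  have h1 := hS.seriesDerivation_map_eq_zero D φ hΔc hDS
  have h2 := hV.seriesDerivation_map_eq_zero D φ hΔc hDV
  have hJ0 : Φ (kernelRoot (PowerSeries.C t * PowerSeries.X) w (ι w)) ≠ 0 := by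
    intro h
    have := congrArg PowerSeries.constantCoeff h
    simp [Φ, kernelRoot, PowerSeries.constantCoeff_map_apply, hw0, hwi0] at this
  have hΔJ : Δ (Φ (kernelRoot (PowerSeries.C t * PowerSeries.X) w (ι w))) = 0 := by
    simp only [kernelRoot, map_add, map_sub, map_one, map_pow, map_mul, Δ.leibniz, Δ.leibniz_pow,
      hΔX, hΔt, hΔw, hΔwi, Δ.map_one_eq_zero, smul_zero, add_zero, sub_zero]
  change Δ (Φ _) = 0 at h1 h2
  rw [map_mul, Δ.leibniz, hΔJ, smul_zero, add_zero, smul_eq_mul, mul_eq_zero, or_iff_right hJ0,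
    map_sub, map_sub] at h2
  rw [map_add, map_add] at h1
  have h3 : Δ (Φ (kernelFst t s w A B ^ 3 * ι w ^ 2) ^ n) = 0 := by
    have : (2 : L⟦X⟧) * Δ (Φ ((kernelFst t s w A B ^ 3 * ι w ^ 2) ^ n)) = 0 := by
      linear_combination h1 + h2
    rw [← map_pow Φ]
    exact (mul_eq_zero.1 this).resolve_left two_ne_zero
  have hH : Φ (kernelFst t s w A B) ≠ 0 := by
    rw [map_ne_zero_iff Φ hΦ]
    intro h
    have := congrArg PowerSeries.constantCoeff h
    rw [constantCoeff_kernelFst, map_zero, neg_eq_zero] at this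
    exact hs0 this
  have hW : Φ (ι w) ≠ 0 := right_ne_zero_of_mul (hWW.trans_ne one_ne_zero)
  rw [map_mul, map_pow Φ _ 3, map_pow Φ _ 2] at h3
  have h4 := Δ.eq_zero_of_pow (mul_ne_zero (pow_ne_zero 3 hH) (pow_ne_zero 2 hW)) hn0 h3
  rw [Δ.leibniz, Δ.leibniz_pow _ 2, hΔwi, smul_zero, smul_zero, smul_zero, zero_add, smul_eq_mul,
    mul_eq_zero, or_iff_right (pow_ne_zero 2 hW)] at h4
  have h5 := congrArg (PowerSeries.coeff 1) (Δ.eq_zero_of_pow hH three_ne_zero h4)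
  simp only [Δ, Φ, coeff_seriesDerivation, PowerSeries.coeff_map, coeff_one_kernelFst hw0, map_sub,
    map_mul, map_pow, map_one, map_zero, D.leibniz, D.leibniz_pow, hDt, hDs, D.map_one_eq_zero,
    smul_zero, add_zero, zero_sub, sub_zero, neg_eq_zero] at h5
  rw [smul_eq_mul, mul_eq_zero, mul_eq_zero] at h5
  refine h5.resolve_left ?_
  rw [not_or]
  refine ⟨sub_ne_zero.2 fun h => hs3 (hφ ?_), pow_ne_zero 2 ((map_ne_zero_iff φ hφ).2 ht)⟩
  rw [map_pow, map_one, ← h]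
end

section
open scoped PowerSeries

theorem derivation_wedge_eq_zero {R : Type*} [CommRing R] [IsDomain R] [Algebra ℂ R] {t : R}
    {ε : R →+* ℂ} (ht : t ≠ 0) (hεt : ε t = 0) (hε : ∀ r, ε r = 0 → t ∣ r)
    (hsep : ∀ r : R, (∀ N, t ^ N ∣ r) → r = 0) {s : ℂ} {m : ℕ} (hm : 0 < m) (hsm : s ^ m = 1)
    (hs3 : s ^ 3 ≠ 1) (f g : ℕ → ℕ → R)
    (hf : ∀ N a, f N a = algebraMap ℂ R (wedgeWeight s N (a, 0)) + t * f (N + 1) a)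
    (hg : ∀ N a, g N a = algebraMap ℂ R (wedgeWeight s N (0, a)) + t * g (N + 1) a)
    {k₀ L : Type*} [CommRing k₀] [Field L] [CharZero L] [Algebra k₀ L] (φ : R →+* L)
    (hφ : Function.Injective φ) (D : Derivation k₀ L L) (hDt : D (φ t) = 0)
    (hDs : D (φ (algebraMap ℂ R s)) = 0) : D (φ (f 0 0)) = 0 := by
  obtain ⟨w, ι, hw, hιw, hιX, hw0⟩ := PowerSeries.exists_kernel_involution t
  have hs : s ≠ 0 := by
    rintro rfl
    simp [hm.ne'] at hsm
  have hι : PowerSeries.X * ι PowerSeries.X = PowerSeries.X + ι PowerSeries.X +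
      PowerSeries.C t ^ 3 * PowerSeries.X ^ 2 * ι PowerSeries.X ^ 2 := by
    rw [hιX]
    linear_combination PowerSeries.X * hw - PowerSeries.X * w * hιw
  have hAB := wedge_kernel_equation ht hsep hs ι hι f g hf hg
  rw [PowerSeries.algebraMap_apply, PowerSeries.algebraMap_apply] at hAB
  have key := derivation_constantCoeff_eq_zero (s := algebraMap ℂ R s) (s' := algebraMap ℂ R s⁻¹)
    (n := 2 * m) ht hεt hε hsep (by rw [← map_mul, mul_inv_cancel₀ hs, map_one]) hw hιw hιX hw0
    (mk_mem_polySubalgebra t (f 0)) (mk_mem_polySubalgebra t (g 0))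
    hAB (by omega) (even_two_mul m)
    (by rw [← map_pow, show 3 * (2 * m) = m * 6 by ring, pow_mul, hsm, one_pow, map_one])
    (by rwa [← map_pow, Ne, map_eq_one_iff _ (algebraMap ℂ R).injective]) φ hφ D hDt hDs
  simpa [← PowerSeries.coeff_zero_eq_constantCoeff_apply] using key

theorem derivation_mk_wedgeWeight_eq_zero {s : ℂ} {m : ℕ} (hm : 0 < m) (hsm : s ^ m = 1)
    (hs3 : s ^ 3 ≠ 1) {L : Type*} [Field L] [Algebra ℂ L] (φ : ℂ⟦X⟧ →ₐ[ℂ] L)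
    (hφ : Function.Injective φ) (D : Derivation ℂ L L) (hDt : D (φ PowerSeries.X) = 0) :
    D (φ (PowerSeries.mk fun n => wedgeWeight s n (0, 0))) = 0 := by
  have : CharZero L := charZero_of_injective_algebraMap (algebraMap ℂ L).injective
  have hmk (u : ℕ → ℂ) (N : ℕ) : PowerSeries.mk (fun n => u (n + N)) =
      algebraMap ℂ ℂ⟦X⟧ (u N) + PowerSeries.X * PowerSeries.mk fun n => u (n + (N + 1)) := by
    ext n
    rcases n with - | n
    · simp
    · simp [PowerSeries.coeff_succ_X_mul, add_right_comm, add_assoc]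
  exact derivation_wedge_eq_zero (t := PowerSeries.X) (ε := PowerSeries.constantCoeff)
    PowerSeries.X_ne_zero PowerSeries.constantCoeff_X (fun r => PowerSeries.X_dvd_iff.2)
    (fun r hr => by
      ext n
      exact PowerSeries.X_pow_dvd_iff.1 (hr (n + 1)) n n.lt_succ_self) hm hsm hs3
    (fun N a => PowerSeries.mk fun n => wedgeWeight s (n + N) (a, 0))
    (fun N b => PowerSeries.mk fun n => wedgeWeight s (n + N) (0, b))
    (fun N a => hmk (fun n => wedgeWeight s n (a, 0)) N)
    (fun N b => hmk (fun n => wedgeWeight s n (0, b)) N) φ.toRingHom hφ D hDt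
    (by
      change D (φ _) = 0
      rw [φ.commutes, D.map_algebraMap])
end

/-- Corollary 3, cell-centred case: for a root of unity `s` with `s³ ≠ 1`,
the power series `E(t,s)` is algebraic over `ℂ(t)`. -/
theorem cell_generating_function_algebraic
    (s : ℂ) (hs : ∃ m : ℕ, 0 < m ∧ s ^ m = 1) (hs3 : s ^ 3 ≠ 1) :
    ∃ P : MvPolynomial (Fin 2) ℂ, P ≠ 0 ∧
      MvPolynomial.aeval
        ![(PowerSeries.X : PowerSeries ℂ),
          PowerSeries.mk fun n => ∑' k : ℤ, (eCell n k : ℂ) * s ^ k] P = 0 := by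
  obtain ⟨m, hm, hsm⟩ := hs
  set E : PowerSeries ℂ := PowerSeries.mk fun n => ∑' k : ℤ, (eCell n k : ℂ) * s ^ k with hE
  by_contra! hP
  have hind : AlgebraicIndependent ℂ ![(PowerSeries.X : PowerSeries ℂ), E] :=
    (injective_iff_map_eq_zero _).2 fun P h => by_contra fun h0 => hP P h0 h
  let φ := IsScalarTower.toAlgHom ℂ (PowerSeries ℂ) (FractionRing (PowerSeries ℂ))
  have hφ : Function.Injective φ := IsFractionRing.injective _ _
  obtain ⟨D, hD⟩ := (hind.map' hφ).exists_derivation ![0, 1]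
  have h0 : D (φ PowerSeries.X) = 0 := hD 0
  have h1 : D (φ E) = 1 := hD 1
  have h2 := derivation_mk_wedgeWeight_eq_zero hm hsm hs3 φ hφ D h0
  simp only [wedgeWeight_apply_zero] at h2
  exact one_ne_zero (h1.symm.trans h2)
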